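/- Let A, B ⊂ ℝ be finite sets. Then C₄(A,B) − |B||A|⁴ − |A||B|⁴ ≪ |B||A|³ + |A||B|³ + (E⁺(A)·E⁺(B))^{1/10} · C₃(A,B)^{2/5} · |A|^{8/5}|B|^{6/5} log^{2/5}|A| + (Ē^×(A)·Ē^×(B))^{1/4} · |A|²|B|^{3/2} log^{3/2}|A|, where ≪ denotes an inequality up to an absolute multiplicative constant. -/

import Mathlib

open scoped Classical Pointwise

noncomputable section

/-- Number of collinear `k`-tuples of points of `A × B`. -/
def Ctuples (F : Type*) [Field F] (k : ℕ) (A B : Finset F) : ℕ :=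
  ((Fintype.piFinset fun _ : Fin k => A ×ˢ B).filter fun f => Collinear F (Set.range f)).card

/-- Additive energy of two finite sets. -/
def addE (F : Type*) [Field F] (A B : Finset F) : ℕ :=
  (((A ×ˢ A) ×ˢ B ×ˢ B).filter fun q => q.1.1 - q.2.1 = q.1.2 - q.2.2).card

/-- Multiplicative energy of two finite sets. -/
def mulE (F : Type*) [Field F] (A B : Finset F) : ℕ :=
  (((A ×ˢ A) ×ˢ B ×ˢ B).filter fun q => q.1.1 * q.2.2 = q.1.2 * q.2.1).card

/-- `max_s E^×(A - s)`. -/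
def mulEbar (F : Type*) [Field F] (A : Finset F) : ℕ :=
  ⨆ s : F, mulE F (A.image fun a => a - s) (A.image fun a => a - s)

def repSub (F : Type*) [Field F] (A B : Finset F) (x : F) : ℕ :=
  ((A ×ˢ B).filter fun q => q.1 - q.2 = x).card

def addEk (F : Type*) [Field F] (k : ℕ) (A : Finset F) : ℕ :=
  ∑ x ∈ A - A, repSub F A A x ^ k

def repDiv (F : Type*) [Field F] (A B : Finset F) (x : F) : ℕ :=
  ((A ×ˢ B).filter fun q => q.2 ≠ 0 ∧ q.1 / q.2 = x).card

def mulEk (F : Type*) [Field F] (k : ℕ) (A : Finset F) : ℕ :=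
  ∑ x ∈ A / A, repDiv F A A x ^ k

def mulEkbar (F : Type*) [Field F] (k : ℕ) (A : Finset F) : ℕ :=
  ⨆ s : F, mulEk F k (A.image fun a => a - s)

/-- Number of points of `A × B` on the graph of `x ↦ l.1 * x + l.2`. -/
def nPts {F : Type*} [Field F] (A B : Finset F) (l : F × F) : ℕ :=
  ((A ×ˢ B).filter fun q => q.2 = l.1 * q.1 + l.2).card

/-- τ-rich lines of `𝓛`. -/
def Lrich {F : Type*} [Field F] (A B : Finset F) (L : Finset (F × F)) (τ : ℝ) : Finset (F × F) :=
  L.filter fun l => τ ≤ (nPts A B l : ℝ)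

def affMap {F : Type*} [Field F] (l : F × F) : F → F := fun x => l.1 * x + l.2

def affInv {F : Type*} [Field F] (l : F × F) : F → F := fun x => (x - l.2) / l.1

/-- alternating product `l₁ ∘ l₂⁻¹ ∘ l₃ ∘ l₄⁻¹ ∘ ⋯` in the affine group. -/
def altAff {F : Type*} [Field F] {k : ℕ} (a : Fin k → F × F) : F → F :=
  (List.ofFn fun i : Fin k => if (i : ℕ) % 2 = 0 then affMap (a i) else affInv (a i)).foldr
    (· ∘ ·) id

def TaffSet {F : Type*} [Field F] (k : ℕ) (L : Finset (F × F)) : ℕ :=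
  (((Fintype.piFinset fun _ : Fin k => L) ×ˢ Fintype.piFinset fun _ : Fin k => L).filter
    fun q => altAff q.1 = altAff q.2).card

def affEnergy {F : Type*} [Field F] (L : Finset (F × F)) : ℕ :=
  (((L ×ˢ L) ×ˢ L ×ˢ L).filter fun q =>
    affMap q.1.1 ∘ affInv q.1.2 = affMap q.2.1 ∘ affInv q.2.2).card

/-- incidences between `A × B` and the graphs of the maps in `L`. -/
def nInc {F : Type*} [Field F] (A B : Finset F) (L : Finset (F × F)) : ℕ :=
  (((A ×ˢ B) ×ˢ L).filter fun q => q.1.2 = q.2.1 * q.1.1 + q.2.2).card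

/-- balanced function of `A ⊆ 𝔽_p`. -/
def balanced {p : ℕ} [NeZero p] (A : Finset (ZMod p)) : ZMod p → ℝ :=
  fun x => (if x ∈ A then 1 else 0) - (A.card : ℝ) / p

def addEfun {p : ℕ} [NeZero p] (f : ZMod p → ℝ) : ℝ :=
  ∑ x, ∑ y, ∑ z, ∑ w, if x - y = z - w then f x * f y * f z * f w else 0

def mulEfun {p : ℕ} [NeZero p] (f : ZMod p → ℝ) : ℝ :=
  ∑ x, ∑ y, ∑ z, ∑ w, if x * w = z * y then f x * f y * f z * f w else 0

def mulEbarFun {p : ℕ} [NeZero p] (f : ZMod p → ℝ) : ℝ :=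
  ⨆ s : ZMod p, mulEfun fun x => f (x + s)

/-- a line in the plane: `inl (a,b)` is `y = a x + b`, `inr c` is `x = c`. -/
def onLine {F : Type*} [Field F] (l : (F × F) ⊕ F) (q : F × F) : Prop :=
  match l with
  | .inl ab => q.2 = ab.1 * q.1 + ab.2
  | .inr c => q.1 = c

def iLine {F : Type*} [Field F] (A B : Finset F) (l : (F × F) ⊕ F) : ℕ :=
  ((A ×ˢ B).filter fun q => onLine l q).card

def altSum {M : Type*} [AddCommGroup M] {k : ℕ} (x : Fin k → M) : M :=
  ∑ i : Fin k, if (i : ℕ) % 2 = 0 then x i else -x i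

def TaddSet {M : Type*} [AddCommGroup M] (k : ℕ) (A : Finset M) : ℕ :=
  (((Fintype.piFinset fun _ : Fin k => A) ×ˢ Fintype.piFinset fun _ : Fin k => A).filter
    fun q => altSum q.1 = altSum q.2).card

def TaddFun {p : ℕ} [NeZero p] (k : ℕ) (f : ZMod p → ℝ) : ℝ :=
  ∑ x : Fin k → ZMod p, ∑ y : Fin k → ZMod p,
    if altSum x = altSum y then (∏ i, f (x i)) * ∏ i, f (y i) else 0

def TaffFun {p : ℕ} [Fact p.Prime] (k : ℕ) (f : ZMod p × ZMod p → ℝ) : ℝ :=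
  ∑ a ∈ Fintype.piFinset fun _ : Fin k => (Finset.univ.filter fun l : ZMod p × ZMod p => l.1 ≠ 0),
    ∑ b ∈ Fintype.piFinset fun _ : Fin k => (Finset.univ.filter fun l : ZMod p × ZMod p => l.1 ≠ 0),
      if altAff a = altAff b then (∏ i, f (a i)) * ∏ i, f (b i) else 0

/-- `Ẽ^×_k (X, Y)`. -/
def tmulEk (F : Type*) [Field F] (k : ℕ) (X Y : Finset F) : ℕ :=
  (((Fintype.piFinset fun _ : Fin k => X.erase 0) ×ˢ
      Fintype.piFinset fun _ : Fin k => Y.erase 0).filter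
    fun q => ∀ i j : Fin k, q.1 i * q.2 j = q.1 j * q.2 i).card

def addEkG {G : Type*} [AddCommGroup G] (k : ℕ) (A : Finset G) : ℕ :=
  ∑ x ∈ A - A, (((A ×ˢ A).filter fun q => q.1 - q.2 = x).card) ^ k

end

/-- Height at `x` of the line `y = l.1 * x + l.2` -/
def lineAt (l : ℝ × ℝ) (x : ℝ) : ℝ := l.1 * x + l.2

/-- Left endpoint of the edge `e`, that is, of the part of the line `e.1` over `[e.2.1, e.2.2]`. -/
def edgeLeft (e : (ℝ × ℝ) × (ℝ × ℝ)) : ℝ × ℝ := (e.2.1, lineAt e.1 e.2.1)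

/-- Right endpoint of an edge. -/
def edgeRight (e : (ℝ × ℝ) × (ℝ × ℝ)) : ℝ × ℝ := (e.2.2, lineAt e.1 e.2.2)

lemma exists_lineAt_eq {l l' : ℝ × ℝ} {x y : ℝ} (hxy : x < y)
    (hx : lineAt l x < lineAt l' x) (hy : lineAt l' y < lineAt l y) :
    ∃ z, x < z ∧ z < y ∧ lineAt l z = lineAt l' z := by
  unfold lineAt at *
  have hd : 0 < l.1 - l'.1 := by
    by_contra h
    nlinarith
  refine ⟨(l'.2 - l.2) / (l.1 - l'.1), ?_, ?_, ?_⟩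
  · rw [lt_div_iff₀ hd]; linarith
  · rw [div_lt_iff₀ hd]; linarith
  · field_simp; ring

lemma lineAt_injOn {l l' : ℝ × ℝ} {x y : ℝ} (hne : x ≠ y) (hx : lineAt l x = lineAt l' x)
    (hy : lineAt l y = lineAt l' y) : l = l' := by
  unfold lineAt at *
  have h1 : (l.1 - l'.1) * (x - y) = 0 := by linarith
  have h2 : l.1 = l'.1 := by
    rcases mul_eq_zero.1 h1 with h | h
    · linarith
    · exact absurd (by linarith) hne
  rw [h2] at hx
  exact Prod.ext h2 (by linarith)

/-- A family of edges with endpoints in `V` that forms a plane straight-line graph. -/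
structure IsPlane (V : Finset (ℝ × ℝ)) (F : Finset ((ℝ × ℝ) × (ℝ × ℝ))) : Prop where
  left : ∀ e ∈ F, edgeLeft e ∈ V
  right : ∀ e ∈ F, edgeRight e ∈ V
  lt : ∀ e ∈ F, e.2.1 < e.2.2
  vertex : ∀ e ∈ F, ∀ w ∈ V, e.2.1 < w.1 → w.1 < e.2.2 → w.2 ≠ lineAt e.1 w.1
  cross : ∀ e ∈ F, ∀ f ∈ F, e ≠ f → ∀ x, e.2.1 < x → x < e.2.2 → f.2.1 < x → x < f.2.2 →
    lineAt e.1 x ≠ lineAt f.1 x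

namespace IsPlane

variable {V : Finset (ℝ × ℝ)} {F : Finset ((ℝ × ℝ) × (ℝ × ℝ))}

lemma eq_of_left (h : IsPlane V F) {e f : (ℝ × ℝ) × (ℝ × ℝ)} (he : e ∈ F) (hf : f ∈ F)
    (hl : edgeLeft e = edgeLeft f) (hs : e.1.1 = f.1.1) : e = f := by
  by_contra hne
  simp only [edgeLeft, lineAt, Prod.mk.injEq] at hl
  obtain ⟨x, hx1, hx2⟩ := exists_between (lt_min (h.lt e he) (hl.1 ▸ h.lt f hf))
  rw [lt_min_iff] at hx2
  refine h.cross e he f hf hne x hx1 hx2.1 (hl.1 ▸ hx1) hx2.2 ?_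
  simp only [lineAt, ← hs]
  rw [← hl.1, ← hs] at hl
  linarith [hl.2]

lemma eq_of_right (h : IsPlane V F) {e f : (ℝ × ℝ) × (ℝ × ℝ)} (he : e ∈ F) (hf : f ∈ F)
    (hl : edgeRight e = edgeRight f) (hs : e.1.1 = f.1.1) : e = f := by
  by_contra hne
  simp only [edgeRight, lineAt, Prod.mk.injEq] at hl
  obtain ⟨x, hx1, hx2⟩ := exists_between (max_lt (h.lt e he) (hl.1 ▸ h.lt f hf))
  rw [max_lt_iff] at hx1
  refine h.cross e he f hf hne x hx1.1 hx2 hx1.2 (hl.1 ▸ hx2) ?_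
  simp only [lineAt, ← hs]
  rw [← hl.1, ← hs] at hl
  linarith [hl.2]

lemma card_top_left_le (h : IsPlane V F) :
    (F.filter fun e => ∀ f ∈ F, edgeLeft f = edgeLeft e → f.1.1 ≤ e.1.1).card ≤ V.card := by
  refine Finset.card_le_card_of_injOn edgeLeft (fun e he => ?_) fun e he f hf hef => ?_
  · exact h.left e (Finset.mem_filter.1 he).1
  · simp only [Finset.coe_filter, Set.mem_ofPred_eq] at he hf
    exact h.eq_of_left he.1 hf.1 hef
      (le_antisymm (hf.2 e he.1 hef) (he.2 f hf.1 hef.symm))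

lemma card_top_right_le (h : IsPlane V F) :
    (F.filter fun e => ∀ f ∈ F, edgeRight f = edgeRight e → e.1.1 ≤ f.1.1).card ≤ V.card := by
  refine Finset.card_le_card_of_injOn edgeRight (fun e he => ?_) fun e he f hf hef => ?_
  · exact h.right e (Finset.mem_filter.1 he).1
  · simp only [Finset.coe_filter, Set.mem_ofPred_eq] at he hf
    exact h.eq_of_right he.1 hf.1 hef
      (le_antisymm (he.2 f hf.1 hef.symm) (hf.2 e he.1 hef))

lemma card_bottom_right_le (h : IsPlane V F) :
    (F.filter fun e => ∀ f ∈ F, edgeRight f = edgeRight e → f.1.1 ≤ e.1.1).card ≤ V.card := by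
  refine Finset.card_le_card_of_injOn edgeRight (fun e he => ?_) fun e he f hf hef => ?_
  · exact h.right e (Finset.mem_filter.1 he).1
  · simp only [Finset.coe_filter, Set.mem_ofPred_eq] at he hf
    exact h.eq_of_right he.1 hf.1 hef
      (le_antisymm (hf.2 e he.1 hef) (he.2 f hf.1 hef.symm))

/-- `g` is the edge following `e` counterclockwise among those with the same left endpoint. -/
def IsNext (F : Finset ((ℝ × ℝ) × (ℝ × ℝ))) (e g : (ℝ × ℝ) × (ℝ × ℝ)) : Prop :=
  g ∈ F ∧ edgeLeft g = edgeLeft e ∧ e.1.1 < g.1.1 ∧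
    ∀ f ∈ F, edgeLeft f = edgeLeft e → e.1.1 < f.1.1 → g.1.1 ≤ f.1.1

lemma exists_isNext {e : (ℝ × ℝ) × (ℝ × ℝ)}
    (he : ¬ ∀ f ∈ F, edgeLeft f = edgeLeft e → f.1.1 ≤ e.1.1) : ∃ g, IsNext F e g := by
  push Not at he
  obtain ⟨f, hf, hfl, hfs⟩ := he
  obtain ⟨g, hg, hmin⟩ := Finset.exists_min_image
    (F.filter fun f => edgeLeft f = edgeLeft e ∧ e.1.1 < f.1.1) (fun f => f.1.1)
    ⟨f, Finset.mem_filter.2 ⟨hf, hfl, hfs⟩⟩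
  simp only [Finset.mem_filter] at hg hmin
  exact ⟨g, hg.1, hg.2.1, hg.2.2, fun f hf h1 h2 => hmin f ⟨hf, h1, h2⟩⟩

/-- The vertices strictly between `e` and `g`. -/
noncomputable def between (V : Finset (ℝ × ℝ)) (e g : (ℝ × ℝ) × (ℝ × ℝ)) : Finset (ℝ × ℝ) :=
  V.filter fun w => e.2.1 < w.1 ∧ w.1 < e.2.2 ∧ w.1 < g.2.2 ∧
    lineAt e.1 w.1 < w.2 ∧ w.2 < lineAt g.1 w.1

lemma lineAt_lt_of_left {e g : (ℝ × ℝ) × (ℝ × ℝ)} (hl : edgeLeft g = edgeLeft e)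
    (hs : e.1.1 < g.1.1) {x : ℝ} (hx : e.2.1 < x) : lineAt e.1 x < lineAt g.1 x := by
  simp only [edgeLeft, lineAt, Prod.mk.injEq] at hl ⊢
  rw [hl.1] at hl
  nlinarith [hl.2]

lemma between_nonempty_of_lower (h : IsPlane V F) {e g f : (ℝ × ℝ) × (ℝ × ℝ)} (he : e ∈ F)
    (hg : IsNext F e g) (hf : f ∈ F) (hfr : edgeRight f = edgeRight e) (hfs : f.1.1 < e.1.1)
    (hle : e.2.2 ≤ g.2.2) : (between V e g).Nonempty := by
  obtain ⟨hgF, hgl, hgs, -⟩ := hg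
  have hlg : ∀ x, e.2.1 < x → lineAt e.1 x < lineAt g.1 x := fun x hx => lineAt_lt_of_left hgl hgs hx
  have hr : f.2.2 = e.2.2 ∧ lineAt f.1 f.2.2 = lineAt e.1 e.2.2 := by
    simpa [edgeRight] using hfr
  have hgl' : g.2.1 = e.2.1 ∧ lineAt g.1 g.2.1 = lineAt e.1 e.2.1 := by
    simpa [edgeLeft] using hgl
  have hre : lineAt f.1 e.2.2 = lineAt e.1 e.2.2 := hr.1 ▸ hr.2
  have hab : ∀ x, x < e.2.2 → lineAt e.1 x < lineAt f.1 x := by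
    intro x hx
    simp only [lineAt] at hre ⊢
    nlinarith
  have hfg : f ≠ g := by rintro rfl; linarith
  have hlt := h.lt e he
  have hend : lineAt f.1 e.2.2 < lineAt g.1 e.2.2 := hre ▸ hlg _ hlt
  have hflt := h.lt f hf
  have key : ∀ x, f.2.1 ≤ x → e.2.1 ≤ x → x < e.2.2 → ¬ lineAt g.1 x < lineAt f.1 x := by
    intro x h1 h2 h3 h4
    obtain ⟨z, hz1, hz2, hz3⟩ := exists_lineAt_eq h3 h4 hend
    refine h.cross f hf g hgF hfg z (by linarith) (by linarith) (by linarith) (by linarith) hz3.symm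
  have hfx : e.2.1 < f.2.1 := by
    by_contra hcon
    push Not at hcon
    refine key e.2.1 hcon le_rfl hlt ?_
    have h1 := hab e.2.1 hlt
    have h2 := hgl'.2
    rw [hgl'.1] at h2
    linarith
  refine ⟨edgeLeft f, Finset.mem_filter.2 ⟨h.left f hf, hfx, ?_, ?_, ?_, ?_⟩⟩
  · simp only [edgeLeft]; linarith
  · simp only [edgeLeft]; linarith
  · simp only [edgeLeft]; exact hab _ (by linarith)
  · simp only [edgeLeft]
    refine lt_of_le_of_ne (not_lt.1 (key f.2.1 le_rfl hfx.le (by linarith))) ?_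
    exact h.vertex g hgF (edgeLeft f) (h.left f hf) (by simp only [edgeLeft]; linarith)
      (by simp only [edgeLeft]; linarith)

lemma between_nonempty_of_upper (h : IsPlane V F) {e g f : (ℝ × ℝ) × (ℝ × ℝ)} (he : e ∈ F)
    (hg : IsNext F e g) (hf : f ∈ F) (hfr : edgeRight f = edgeRight g) (hfs : g.1.1 < f.1.1)
    (hle : g.2.2 ≤ e.2.2) : (between V e g).Nonempty := by
  obtain ⟨hgF, hgl, hgs, -⟩ := hg
  have hlg : ∀ x, e.2.1 < x → lineAt e.1 x < lineAt g.1 x := fun x hx => lineAt_lt_of_left hgl hgs hx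
  have hr : f.2.2 = g.2.2 ∧ lineAt f.1 f.2.2 = lineAt g.1 g.2.2 := by
    simpa [edgeRight] using hfr
  have hgl' : g.2.1 = e.2.1 ∧ lineAt g.1 g.2.1 = lineAt e.1 e.2.1 := by
    simpa [edgeLeft] using hgl
  have hre : lineAt f.1 g.2.2 = lineAt g.1 g.2.2 := hr.1 ▸ hr.2
  have hab : ∀ x, x < g.2.2 → lineAt f.1 x < lineAt g.1 x := by
    intro x hx
    simp only [lineAt] at hre ⊢
    nlinarith
  have hfe : f ≠ e := by rintro rfl; linarith
  have hlt := h.lt g hgF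
  have hend : lineAt e.1 g.2.2 < lineAt f.1 g.2.2 := hre ▸ hlg _ (by linarith)
  have hflt := h.lt f hf
  have key : ∀ x, f.2.1 ≤ x → e.2.1 ≤ x → x < g.2.2 → ¬ lineAt f.1 x < lineAt e.1 x := by
    intro x h1 h2 h3 h4
    obtain ⟨z, hz1, hz2, hz3⟩ := exists_lineAt_eq h3 h4 hend
    refine h.cross f hf e he hfe z (by linarith) (by linarith) (by linarith) (by linarith) hz3
  have hfx : e.2.1 < f.2.1 := by
    by_contra hcon
    push Not at hcon
    refine key e.2.1 hcon le_rfl (by linarith) ?_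
    have h1 := hab e.2.1 (by linarith)
    have h2 := hgl'.2
    rw [hgl'.1] at h2
    linarith
  refine ⟨edgeLeft f, Finset.mem_filter.2 ⟨h.left f hf, hfx, ?_, ?_, ?_, ?_⟩⟩
  · simp only [edgeLeft]; linarith
  · simp only [edgeLeft]; linarith
  · simp only [edgeLeft]
    refine lt_of_le_of_ne (not_lt.1 (key f.2.1 le_rfl hfx.le (by linarith))) ?_
    exact (h.vertex e he (edgeLeft f) (h.left f hf) (by simp only [edgeLeft]; linarith)
      (by simp only [edgeLeft]; linarith)).symm
  · simp only [edgeLeft]; exact hab _ (by linarith)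

lemma eq_of_leftmost_between (h : IsPlane V F) {e g e' g' : (ℝ × ℝ) × (ℝ × ℝ)} {w : ℝ × ℝ}
    (he : e ∈ F) (hg : IsNext F e g) (he' : e' ∈ F) (hg' : IsNext F e' g')
    (hw : w ∈ between V e g) (hmin : ∀ v ∈ between V e g, w.1 ≤ v.1)
    (hw' : w ∈ between V e' g') (hle : e.2.1 ≤ e'.2.1) : e = e' := by
  obtain ⟨hgF, hgl, hgs, hgn⟩ := hg
  obtain ⟨hgF', hgl', hgs', hgn'⟩ := hg'
  obtain ⟨-, w1, w2, w3, w4, w5⟩ := Finset.mem_filter.1 hw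
  obtain ⟨-, w1', w2', w3', w4', w5'⟩ := Finset.mem_filter.1 hw'
  by_cases hu : edgeLeft e = edgeLeft e'
  · rcases lt_trichotomy e.1.1 e'.1.1 with hs | hs | hs
    · have h1 := hgn e' he' hu.symm hs
      have h2 : lineAt g.1 w.1 ≤ lineAt e'.1 w.1 := by
        rcases h1.lt_or_eq with h3 | h3
        · refine (lineAt_lt_of_left (hu.symm.trans hgl.symm) h3 ?_).le
          have : g.2.1 = e.2.1 := (Prod.ext_iff.1 hgl).1
          linarith
        · rw [h.eq_of_left hgF he' (hgl.trans hu) h3]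
      linarith
    · exact h.eq_of_left he he' hu hs
    · have h1 := hgn' e he hu hs
      have h2 : lineAt g'.1 w.1 ≤ lineAt e.1 w.1 := by
        rcases h1.lt_or_eq with h3 | h3
        · refine (lineAt_lt_of_left (hu.trans hgl'.symm) h3 ?_).le
          have : g'.2.1 = e'.2.1 := (Prod.ext_iff.1 hgl').1
          linarith
        · rw [h.eq_of_left hgF' he (hgl'.trans hu.symm) h3]
      linarith
  · exfalso
    have hgx : g.2.1 = e.2.1 := (Prod.ext_iff.1 hgl).1
    have hgx' : g'.2.1 = e'.2.1 := (Prod.ext_iff.1 hgl').1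
    have hgy : lineAt g.1 e.2.1 = lineAt e.1 e.2.1 := by
      have := congrArg Prod.snd hgl
      simpa [edgeLeft, hgx] using this
    have hgy' : lineAt g'.1 e'.2.1 = lineAt e'.1 e'.2.1 := by
      have := congrArg Prod.snd hgl'
      simpa [edgeLeft, hgx'] using this
    have h1 : lineAt e'.1 e'.2.1 ≤ lineAt g.1 e'.2.1 := by
      by_contra hcon
      push Not at hcon
      obtain ⟨z, hz1, hz2, hz3⟩ := exists_lineAt_eq w1' hcon (w4'.trans w5)
      refine h.cross g hgF e' he' ?_ z (by linarith) (by linarith) (by linarith) (by linarith) hz3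
      rintro rfl
      exact hcon.ne rfl
    have h2 : lineAt e.1 e'.2.1 ≤ lineAt e'.1 e'.2.1 := by
      by_contra hcon
      push Not at hcon
      rw [← hgy'] at hcon
      obtain ⟨z, hz1, hz2, hz3⟩ := exists_lineAt_eq w1' hcon (w4.trans w5')
      refine h.cross g' hgF' e he ?_ z (by linarith) (by linarith) (by linarith) (by linarith) hz3
      rintro rfl
      exact hcon.ne rfl
    rcases hle.lt_or_eq with hlt | heq
    · have h3 := h.vertex e he _ (h.left e' he') hlt (by simp only [edgeLeft]; linarith)
      have h4 := h.vertex g hgF _ (h.left e' he') (by simp only [edgeLeft]; linarith)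
        (by simp only [edgeLeft]; linarith)
      simp only [edgeLeft] at h3 h4
      have h5 := hmin (edgeLeft e') (Finset.mem_filter.2 ⟨h.left e' he', hlt,
        by simp only [edgeLeft]; linarith, by simp only [edgeLeft]; linarith,
        lt_of_le_of_ne h2 h3.symm, lt_of_le_of_ne h1 h4⟩)
      simp only [edgeLeft] at h5
      linarith
    · rw [← heq] at h1 h2
      rw [hgy] at h1
      apply hu
      simp only [edgeLeft, ← heq, le_antisymm h2 h1]

/-- A plane straight-line graph has linearly many edges. -/
theorem card_le (h : IsPlane V F) : F.card ≤ 4 * V.card := by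
  set F₁ := F.filter fun e => ∀ f ∈ F, edgeLeft f = edgeLeft e → f.1.1 ≤ e.1.1 with hF₁
  set F₂ := F.filter fun e => ∀ f ∈ F, edgeRight f = edgeRight e → e.1.1 ≤ f.1.1 with hF₂
  set F₂' := F.filter fun e => ∀ f ∈ F, edgeRight f = edgeRight e → f.1.1 ≤ e.1.1 with hF₂'
  set F₃ := F.filter fun e => ∃ g ∈ F₂', IsNext F e g with hF₃
  set F₄ := F.filter fun e => ∃ g, IsNext F e g ∧ (between V e g).Nonempty with hF₄
  have c₁ : F₁.card ≤ V.card := h.card_top_left_le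
  have c₂ : F₂.card ≤ V.card := h.card_top_right_le
  have c₂' : F₂'.card ≤ V.card := h.card_bottom_right_le
  have c₃ : F₃.card ≤ V.card := by
    refine le_trans ?_ c₂'
    choose! g hg1 hg2 using fun e (he : e ∈ F₃) => (Finset.mem_filter.1 he).2
    refine Finset.card_le_card_of_injOn g (fun e he => hg1 e he) fun e he f hf hef => ?_
    have he1 := hg2 e he
    have hf1 := hg2 f hf
    rw [← hef] at hf1
    obtain ⟨-, a1, a2, a3⟩ := he1
    obtain ⟨-, b1, b2, b3⟩ := hf1
    have heF := (Finset.mem_filter.1 he).1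
    have hfF := (Finset.mem_filter.1 hf).1
    have hl : edgeLeft e = edgeLeft f := a1.symm.trans b1
    rcases lt_trichotomy e.1.1 f.1.1 with hs | hs | hs
    · linarith [a3 f hfF hl.symm hs]
    · exact h.eq_of_left heF hfF hl hs
    · linarith [b3 e heF hl hs]
  have c₄ : F₄.card ≤ V.card := by
    have : ∀ e ∈ F₄, ∃ w g, IsNext F e g ∧ w ∈ between V e g ∧
        ∀ v ∈ between V e g, w.1 ≤ v.1 := by
      intro e he
      obtain ⟨g, hg, hne⟩ := (Finset.mem_filter.1 he).2
      obtain ⟨w, hw, hmin⟩ := Finset.exists_min_image _ (fun v : ℝ × ℝ => v.1) hne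
      exact ⟨w, g, hg, hw, hmin⟩
    choose! w g hg hw hmin using this
    refine Finset.card_le_card_of_injOn w (fun e he => (Finset.mem_filter.1 (hw e he)).1)
      fun e he f hf hef => ?_
    have heF := (Finset.mem_filter.1 he).1
    have hfF := (Finset.mem_filter.1 hf).1
    rcases le_total e.2.1 f.2.1 with hle | hle
    · exact h.eq_of_leftmost_between heF (hg e he) hfF (hg f hf) (hw e he) (hmin e he)
        (hef ▸ hw f hf) hle
    · exact (h.eq_of_leftmost_between hfF (hg f hf) heF (hg e he) (hw f hf) (hmin f hf)
        (hef ▸ hw e he) hle).symm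
  have hcov : F ⊆ F₁ ∪ F₂ ∪ F₃ ∪ F₄ := by
    intro e he
    by_contra hcon
    simp only [Finset.mem_union, not_or] at hcon
    obtain ⟨⟨⟨n₁, n₂⟩, n₃⟩, n₄⟩ := hcon
    have n₁' : ¬ ∀ f ∈ F, edgeLeft f = edgeLeft e → f.1.1 ≤ e.1.1 := fun hh =>
      n₁ (Finset.mem_filter.2 ⟨he, hh⟩)
    obtain ⟨g, hg⟩ := exists_isNext n₁'
    refine n₄ (Finset.mem_filter.2 ⟨he, g, hg, ?_⟩)
    rcases le_total e.2.2 g.2.2 with hle | hle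
    · have n₂' : ¬ ∀ f ∈ F, edgeRight f = edgeRight e → e.1.1 ≤ f.1.1 := fun hh =>
        n₂ (Finset.mem_filter.2 ⟨he, hh⟩)
      push Not at n₂'
      obtain ⟨f, hf, hfr, hfs⟩ := n₂'
      exact h.between_nonempty_of_lower he hg hf hfr hfs hle
    · have n₃' : ¬ ∀ f ∈ F, edgeRight f = edgeRight g → f.1.1 ≤ g.1.1 := fun hh =>
        n₃ (Finset.mem_filter.2 ⟨he, g, Finset.mem_filter.2 ⟨hg.1, hh⟩, hg⟩)
      push Not at n₃'
      obtain ⟨f, hf, hfr, hfs⟩ := n₃'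
      exact h.between_nonempty_of_upper he hg hf hfr hfs hle
  have := (Finset.card_le_card hcov).trans (Finset.card_union_le _ _)
  have := Finset.card_union_le (F₁ ∪ F₂) F₃
  have := Finset.card_union_le F₁ F₂
  omega

end IsPlane

lemma sum_powerset_weight {α : Type*} [DecidableEq α] (P S : Finset α) (hS : S ⊆ P) (p : ℝ) :
    ∑ V ∈ P.powerset, (p ^ V.card * (1 - p) ^ (P \ V).card) * (if S ⊆ V then 1 else 0)
      = p ^ S.card := by
  have h := Finset.prod_add (fun _ : α => p) (fun i => if i ∈ S then 0 else 1 - p) P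
  have hl : ∏ i ∈ P, (p + if i ∈ S then 0 else 1 - p) = p ^ S.card := by
    have : ∀ i ∈ P, (p + if i ∈ S then 0 else 1 - p) = if i ∈ S then p else 1 := by
      intro i _
      split_ifs <;> ring
    rw [Finset.prod_congr rfl this, Finset.prod_ite, Finset.prod_const, Finset.prod_const_one,
      mul_one, Finset.filter_mem_eq_inter, Finset.inter_eq_right.2 hS]
  rw [← hl, h]
  refine Finset.sum_congr rfl fun V hV => ?_
  rw [Finset.prod_const, mul_assoc]
  congr 1
  split_ifs with hSV
  · rw [mul_one, ← Finset.prod_const]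
    refine Finset.prod_congr rfl fun i hi => ?_
    rw [if_neg fun hiS => (Finset.mem_sdiff.1 hi).2 (hSV hiS)]
  · rw [mul_zero]
    obtain ⟨i, hiS, hiV⟩ := Finset.not_subset.1 hSV
    symm
    exact Finset.prod_eq_zero (Finset.mem_sdiff.2 ⟨hS hiS, hiV⟩) (if_pos hiS)

/-- Points of `P` on the line `l`. -/
noncomputable def ptsOn (P : Finset (ℝ × ℝ)) (l : ℝ × ℝ) : Finset (ℝ × ℝ) :=
  P.filter fun p => p.2 = lineAt l p.1

lemma mem_ptsOn {P : Finset (ℝ × ℝ)} {l p : ℝ × ℝ} :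
    p ∈ ptsOn P l ↔ p ∈ P ∧ p.2 = lineAt l p.1 := Finset.mem_filter

/-- Segments of lines of `Λ` between consecutive points of `P`. -/
noncomputable def edges (P Λ : Finset (ℝ × ℝ)) : Finset ((ℝ × ℝ) × (ℝ × ℝ)) :=
  (Λ ×ˢ (P.image Prod.fst ×ˢ P.image Prod.fst)).filter fun e =>
    edgeLeft e ∈ P ∧ edgeRight e ∈ P ∧ e.2.1 < e.2.2 ∧
      ∀ x, e.2.1 < x → x < e.2.2 → (x, lineAt e.1 x) ∉ P

lemma mem_edges {P Λ : Finset (ℝ × ℝ)} {e : (ℝ × ℝ) × (ℝ × ℝ)} :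
    e ∈ edges P Λ ↔ e.1 ∈ Λ ∧ edgeLeft e ∈ P ∧ edgeRight e ∈ P ∧ e.2.1 < e.2.2 ∧
      ∀ x, e.2.1 < x → x < e.2.2 → (x, lineAt e.1 x) ∉ P := by
  simp only [edges, Finset.mem_filter, Finset.mem_product]
  constructor
  · rintro ⟨⟨h1, -⟩, h⟩
    exact ⟨h1, h⟩
  · rintro ⟨h1, h2, h3, h⟩
    exact ⟨⟨h1, Finset.mem_image.2 ⟨_, h2, rfl⟩, Finset.mem_image.2 ⟨_, h3, rfl⟩⟩, h2, h3, h⟩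

lemma card_ptsOn_le_card_edges (P Λ : Finset (ℝ × ℝ)) {l : ℝ × ℝ} (hl : l ∈ Λ) :
    (ptsOn P l).card ≤ ((edges P Λ).filter fun e => e.1 = l).card + 1 := by
  rcases (ptsOn P l).eq_empty_or_nonempty with h0 | hne
  · simp [h0]
  obtain ⟨q, hq, hmax⟩ := Finset.exists_max_image _ (fun p : ℝ × ℝ => p.1) hne
  have : ∀ p ∈ (ptsOn P l).erase q, ∃ y, ((l, (p.1, y)) : (ℝ × ℝ) × (ℝ × ℝ)) ∈ edges P Λ := by
    intro p hp
    obtain ⟨hpq, hp⟩ := Finset.mem_erase.1 hp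
    have hp' := mem_ptsOn.1 hp
    have hq' := mem_ptsOn.1 hq
    have hlt : p.1 < q.1 := by
      refine lt_of_le_of_ne (hmax p hp) fun h => hpq (Prod.ext h ?_)
      rw [hp'.2, hq'.2, h]
    obtain ⟨r, hr, hmin⟩ := Finset.exists_min_image ((ptsOn P l).filter fun r => p.1 < r.1)
      (fun p : ℝ × ℝ => p.1) ⟨q, Finset.mem_filter.2 ⟨hq, hlt⟩⟩
    obtain ⟨hr1, hr2⟩ := Finset.mem_filter.1 hr
    have hr' := mem_ptsOn.1 hr1
    refine ⟨r.1, mem_edges.2 ⟨hl, ?_, ?_, hr2, fun x h1 h2 hx => ?_⟩⟩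
    · have : edgeLeft (l, (p.1, r.1)) = p := Prod.ext rfl hp'.2.symm
      rw [this]; exact hp'.1
    · have : edgeRight (l, (p.1, r.1)) = r := Prod.ext rfl hr'.2.symm
      rw [this]; exact hr'.1
    · have := hmin (x, lineAt l x) (Finset.mem_filter.2 ⟨mem_ptsOn.2 ⟨hx, rfl⟩, h1⟩)
      simp only at this h2
      linarith
  choose! y hy using this
  have hc : ((ptsOn P l).erase q).card ≤ ((edges P Λ).filter fun e => e.1 = l).card := by
    refine Finset.card_le_card_of_injOn (fun p => (l, (p.1, y p)))
      (fun p hp => Finset.mem_filter.2 ⟨hy p hp, rfl⟩) fun p hp p' hp' h => ?_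
    have h1 : p.1 = p'.1 := by
      simp only [Prod.mk.injEq, true_and] at h
      exact h.1
    have e1 := (mem_ptsOn.1 (Finset.mem_erase.1 (Finset.mem_coe.1 hp)).2).2
    have e2 := (mem_ptsOn.1 (Finset.mem_erase.1 (Finset.mem_coe.1 hp')).2).2
    exact Prod.ext h1 (by rw [e1, e2, h1])
  rw [Finset.card_erase_of_mem hq] at hc
  omega

lemma sum_card_ptsOn_le (P Λ : Finset (ℝ × ℝ)) :
    ∑ l ∈ Λ, (ptsOn P l).card ≤ (edges P Λ).card + Λ.card := by
  have h : (edges P Λ).card = ∑ l ∈ Λ, ((edges P Λ).filter fun e => e.1 = l).card :=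
    Finset.card_eq_sum_card_fiberwise fun e he => (mem_edges.1 he).1
  rw [h, Finset.card_eq_sum_ones Λ, ← Finset.sum_add_distrib]
  exact Finset.sum_le_sum fun l hl => card_ptsOn_le_card_edges P Λ hl

/-- Two edges on different lines cross in their interiors. -/
def Crosses (e f : (ℝ × ℝ) × (ℝ × ℝ)) : Prop :=
  e.1 ≠ f.1 ∧ ∃ x, e.2.1 < x ∧ x < e.2.2 ∧ f.2.1 < x ∧ x < f.2.2 ∧ lineAt e.1 x = lineAt f.1 x

lemma Crosses.symm {e f : (ℝ × ℝ) × (ℝ × ℝ)} (h : Crosses e f) : Crosses f e := by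
  obtain ⟨hne, x, h1, h2, h3, h4, h5⟩ := h
  exact ⟨hne.symm, x, h3, h4, h1, h2, h5.symm⟩

/-- Ordered pairs of crossing edges. -/
noncomputable def crossings (P Λ : Finset (ℝ × ℝ)) :
    Finset (((ℝ × ℝ) × (ℝ × ℝ)) × ((ℝ × ℝ) × (ℝ × ℝ))) :=
  (edges P Λ ×ˢ edges P Λ).filter fun q => Crosses q.1 q.2

lemma edges_eq_of_mem_interior {P Λ : Finset (ℝ × ℝ)} {e f : (ℝ × ℝ) × (ℝ × ℝ)}
    (he : e ∈ edges P Λ) (hf : f ∈ edges P Λ) (hl : e.1 = f.1) {x : ℝ}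
    (h1 : e.2.1 < x) (h2 : x < e.2.2) (h3 : f.2.1 < x) (h4 : x < f.2.2) : e = f := by
  obtain ⟨-, a1, a2, a3, a4⟩ := mem_edges.1 he
  obtain ⟨-, b1, b2, b3, b4⟩ := mem_edges.1 hf
  simp only [edgeLeft, edgeRight] at a1 a2 b1 b2
  have l1 : e.2.1 = f.2.1 := by
    rcases lt_trichotomy e.2.1 f.2.1 with h | h | h
    · exact absurd (hl ▸ b1) (a4 _ h (by linarith))
    · exact h
    · exact absurd (hl ▸ a1) (b4 _ h (by linarith))
  have l2 : e.2.2 = f.2.2 := by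
    rcases lt_trichotomy e.2.2 f.2.2 with h | h | h
    · exact absurd (hl ▸ a2) (b4 _ (by linarith) h)
    · exact h
    · exact absurd (hl ▸ b2) (a4 _ (by linarith) h)
  exact Prod.ext hl (Prod.ext l1 l2)

lemma card_crossings_le (P Λ : Finset (ℝ × ℝ)) : (crossings P Λ).card ≤ Λ.card ^ 2 := by
  rw [sq, ← Finset.card_product]
  refine Finset.card_le_card_of_injOn (fun q => (q.1.1, q.2.1)) (fun q hq => ?_)
    fun q hq r hr h => ?_
  · obtain ⟨h1, -⟩ := Finset.mem_filter.1 hq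
    obtain ⟨h1, h2⟩ := Finset.mem_product.1 h1
    exact Finset.mem_product.2 ⟨(mem_edges.1 h1).1, (mem_edges.1 h2).1⟩
  · obtain ⟨hq1, hne, x, a1, a2, a3, a4, a5⟩ := Finset.mem_filter.1 hq
    obtain ⟨hr1, -, y, b1, b2, b3, b4, b5⟩ := Finset.mem_filter.1 hr
    obtain ⟨q1, q2⟩ := Finset.mem_product.1 hq1
    obtain ⟨r1, r2⟩ := Finset.mem_product.1 hr1
    simp only [Prod.mk.injEq] at h
    obtain ⟨e1, e2⟩ := h
    have hxy : x = y := by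
      by_contra hxy
      rw [← e1, ← e2] at b5
      exact hne (lineAt_injOn hxy a5 b5)
    subst hxy
    exact Prod.ext (edges_eq_of_mem_interior q1 r1 e1 a1 a2 b1 b2)
      (edges_eq_of_mem_interior q2 r2 e2 a3 a4 b3 b4)

lemma card_edges_in_le (P Λ V : Finset (ℝ × ℝ)) (hV : V ⊆ P) :
    ((edges P Λ).filter fun e => {edgeLeft e, edgeRight e} ⊆ V).card ≤ 4 * V.card +
      ((crossings P Λ).filter fun q =>
        {edgeLeft q.1, edgeRight q.1, edgeLeft q.2, edgeRight q.2} ⊆ V).card := by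
  set E := (edges P Λ).filter fun e => {edgeLeft e, edgeRight e} ⊆ V with hE
  obtain ⟨F, hF, hmax⟩ := Finset.exists_max_image
    (E.powerset.filter fun F => ∀ e ∈ F, ∀ f ∈ F, ¬ Crosses e f) Finset.card
    ⟨∅, by simp⟩
  simp only [Finset.mem_filter, Finset.mem_powerset] at hF hmax
  obtain ⟨hFE, hFc⟩ := hF
  have hEm : ∀ e ∈ E, e ∈ edges P Λ ∧ edgeLeft e ∈ V ∧ edgeRight e ∈ V := by
    intro e he
    obtain ⟨h1, h2⟩ := Finset.mem_filter.1 he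
    exact ⟨h1, h2 (by simp), h2 (by simp)⟩
  have hplane : IsPlane V F := by
    refine ⟨fun e he => (hEm e (hFE he)).2.1, fun e he => (hEm e (hFE he)).2.2,
      fun e he => (mem_edges.1 (hEm e (hFE he)).1).2.2.2.1, fun e he w hw h1 h2 h3 => ?_,
      fun e he f hf hne x h1 h2 h3 h4 h5 => ?_⟩
    · refine (mem_edges.1 (hEm e (hFE he)).1).2.2.2.2 w.1 h1 h2 ?_
      rw [← h3]
      exact hV hw
    · by_cases hl : e.1 = f.1
      · exact hne (edges_eq_of_mem_interior (hEm e (hFE he)).1 (hEm f (hFE hf)).1 hl h1 h2 h3 h4)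
      · exact hFc e he f hf ⟨hl, x, h1, h2, h3, h4, h5⟩
  have hcr : ∀ e ∈ E \ F, ∃ f ∈ F, Crosses e f := by
    intro e he
    obtain ⟨heE, heF⟩ := Finset.mem_sdiff.1 he
    by_contra hcon
    push Not at hcon
    have h1 := hmax (insert e F) ⟨Finset.insert_subset heE hFE, ?_⟩
    · rw [Finset.card_insert_of_notMem heF] at h1
      omega
    · intro a ha b hb hab
      rcases Finset.mem_insert.1 ha with rfl | ha' <;> rcases Finset.mem_insert.1 hb with rfl | hb'
      · exact hab.1 rfl
      · exact hcon b hb' hab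
      · exact hcon a ha' hab.symm
      · exact hFc a ha' b hb' hab
  choose! f hf1 hf2 using hcr
  have hcard : (E \ F).card ≤ ((crossings P Λ).filter fun q =>
      {edgeLeft q.1, edgeRight q.1, edgeLeft q.2, edgeRight q.2} ⊆ V).card := by
    refine Finset.card_le_card_of_injOn (fun e => (e, f e)) (fun e he => ?_)
      fun e _ e' _ h => (Prod.ext_iff.1 h).1
    have a := hEm e (Finset.mem_sdiff.1 he).1
    have b := hEm _ (hFE (hf1 e he))
    refine Finset.mem_filter.2 ⟨Finset.mem_filter.2 ⟨Finset.mem_product.2 ⟨a.1, b.1⟩, hf2 e he⟩, ?_⟩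
    intro v hv
    simp only [Finset.mem_insert, Finset.mem_singleton] at hv
    rcases hv with rfl | rfl | rfl | rfl
    exacts [a.2.1, a.2.2, b.2.1, b.2.2]
  have := hplane.card_le
  have := Finset.card_sdiff_add_card_eq_card hFE
  omega

lemma card_endpoints {P Λ : Finset (ℝ × ℝ)} {e : (ℝ × ℝ) × (ℝ × ℝ)} (he : e ∈ edges P Λ) :
    ({edgeLeft e, edgeRight e} : Finset (ℝ × ℝ)).card = 2 := by
  refine Finset.card_pair fun h => ?_
  exact (mem_edges.1 he).2.2.2.1.ne (Prod.ext_iff.1 h).1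

lemma card_endpoints_crossing {P Λ : Finset (ℝ × ℝ)}
    {q : ((ℝ × ℝ) × (ℝ × ℝ)) × ((ℝ × ℝ) × (ℝ × ℝ))} (hq : q ∈ crossings P Λ) :
    ({edgeLeft q.1, edgeRight q.1, edgeLeft q.2, edgeRight q.2} : Finset (ℝ × ℝ)).card = 4 := by
  obtain ⟨e, f⟩ := q
  obtain ⟨h1, hne, x, a1, a2, a3, a4, a5⟩ := Finset.mem_filter.1 hq
  obtain ⟨he, hf⟩ := Finset.mem_product.1 h1
  simp only at hne a1 a2 a3 a4 a5 he hf ⊢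
  have key : ∀ y z : ℝ, y ≠ x → (y, lineAt e.1 y) ≠ (z, lineAt f.1 z) := by
    intro y z hy h
    obtain ⟨rfl, h⟩ := Prod.ext_iff.1 h
    exact hne (lineAt_injOn hy h a5)
  have e1 : edgeLeft e ≠ edgeRight e := fun h =>
    (mem_edges.1 he).2.2.2.1.ne (Prod.ext_iff.1 h).1
  have f1 : edgeLeft f ≠ edgeRight f := fun h =>
    (mem_edges.1 hf).2.2.2.1.ne (Prod.ext_iff.1 h).1
  have g1 : edgeLeft e ≠ edgeLeft f := key _ _ a1.ne
  have g2 : edgeLeft e ≠ edgeRight f := key _ _ a1.ne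
  have g3 : edgeRight e ≠ edgeLeft f := key _ _ a2.ne'
  have g4 : edgeRight e ≠ edgeRight f := key _ _ a2.ne'
  rw [Finset.card_insert_of_notMem, Finset.card_insert_of_notMem, Finset.card_pair f1]
  · simp [g3, g4]
  · simp [e1, g1, g2]

lemma card_edges_mul_le (P Λ : Finset (ℝ × ℝ)) {p : ℝ} (hp0 : 0 ≤ p) (hp1 : p ≤ 1) :
    (edges P Λ).card * p ^ 2 ≤ 4 * (P.card * p) + (Λ.card : ℝ) ^ 2 * p ^ 4 := by
  set wt : Finset (ℝ × ℝ) → ℝ := fun V => p ^ V.card * (1 - p) ^ (P \ V).card with hwt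
  have hwt0 : ∀ V, 0 ≤ wt V := fun V => by
    have : 0 ≤ 1 - p := by linarith
    positivity
  have havg : ∀ {ι : Type} (s : Finset ι) (S : ι → Finset (ℝ × ℝ)) (k : ℕ),
      (∀ i ∈ s, S i ⊆ P) → (∀ i ∈ s, (S i).card = k) →
      ∑ V ∈ P.powerset, wt V * ((s.filter fun i => S i ⊆ V).card : ℝ) = s.card * p ^ k := by
    intro ι s S k hS hk
    have : ∀ V ∈ P.powerset, wt V * ((s.filter fun i => S i ⊆ V).card : ℝ)
        = ∑ i ∈ s, wt V * (if S i ⊆ V then 1 else 0) := by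
      intro V _
      rw [← Finset.mul_sum, Finset.sum_boole]
    have hterm : ∀ i ∈ s, ∑ V ∈ P.powerset, wt V * (if S i ⊆ V then 1 else 0) = p ^ k :=
      fun i hi => (sum_powerset_weight P (S i) (hS i hi) p).trans (by rw [hk i hi])
    rw [Finset.sum_congr rfl this, Finset.sum_comm, Finset.sum_congr rfl hterm, Finset.sum_const,
      nsmul_eq_mul]
  have hE := havg (edges P Λ) (fun e => {edgeLeft e, edgeRight e}) 2 (fun e he => by
    have := mem_edges.1 he
    intro v hv
    simp only [Finset.mem_insert, Finset.mem_singleton] at hv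
    rcases hv with rfl | rfl
    exacts [this.2.1, this.2.2.1]) fun e he => card_endpoints he
  have hV := havg P (fun v => {v}) 1 (fun v hv => by simpa using hv) (fun v _ => by simp)
  have hC := havg (crossings P Λ)
    (fun q => {edgeLeft q.1, edgeRight q.1, edgeLeft q.2, edgeRight q.2}) 4 (fun q hq => by
    have := Finset.mem_product.1 (Finset.mem_filter.1 hq).1
    have h1 := mem_edges.1 this.1
    have h2 := mem_edges.1 this.2
    intro v hv
    simp only [Finset.mem_insert, Finset.mem_singleton] at hv
    rcases hv with rfl | rfl | rfl | rfl
    exacts [h1.2.1, h1.2.2.1, h2.2.1, h2.2.2.1]) fun q hq => card_endpoints_crossing hq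
  have hsum := Finset.sum_le_sum (s := P.powerset) fun V hV' => by
    have hVP := Finset.mem_powerset.1 hV'
    have h1 := card_edges_in_le P Λ V hVP
    have h2 : (P.filter fun v => {v} ⊆ V) = V := by
      ext v
      simp only [Finset.mem_filter, Finset.singleton_subset_iff]
      exact ⟨fun h => h.2, fun h => ⟨hVP h, h⟩⟩
    have h3 : (((edges P Λ).filter fun e => {edgeLeft e, edgeRight e} ⊆ V).card : ℝ) ≤
        4 * ((P.filter fun v => {v} ⊆ V).card : ℝ) + ((crossings P Λ).filter fun q =>
        {edgeLeft q.1, edgeRight q.1, edgeLeft q.2, edgeRight q.2} ⊆ V).card := by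
      rw [h2]
      exact_mod_cast h1
    exact mul_le_mul_of_nonneg_left h3 (hwt0 V)
  simp only [mul_add, Finset.sum_add_distrib, mul_left_comm _ (4 : ℝ), ← Finset.mul_sum] at hsum
  rw [hE, hV, hC, pow_one] at hsum
  have h4 : ((crossings P Λ).card : ℝ) ≤ (Λ.card : ℝ) ^ 2 := by
    exact_mod_cast card_crossings_le P Λ
  have := mul_le_mul_of_nonneg_right h4 (pow_nonneg hp0 4)
  linarith

/-- The Szemerédi-Trotter theorem, with a free parameter `t`. -/
theorem szemeredi_trotter (P Λ : Finset (ℝ × ℝ)) {t : ℝ} (ht : 1 ≤ t) :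
    (∑ l ∈ Λ, ((ptsOn P l).card : ℝ)) ≤ Λ.card + 4 * P.card * t + (Λ.card : ℝ) ^ 2 / t ^ 2 := by
  have h1 : (∑ l ∈ Λ, ((ptsOn P l).card : ℝ)) ≤ (edges P Λ).card + Λ.card := by
    exact_mod_cast sum_card_ptsOn_le P Λ
  have ht0 : 0 < t := by linarith
  have h2 := card_edges_mul_le P Λ (p := 1 / t) (by positivity) (by
    rw [div_le_one ht0]; exact ht)
  have h3 : ((edges P Λ).card : ℝ) ≤ 4 * P.card * t + (Λ.card : ℝ) ^ 2 / t ^ 2 := by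
    have h4 := mul_le_mul_of_nonneg_right h2 (sq_nonneg t)
    have e1 : ((edges P Λ).card : ℝ) * (1 / t) ^ 2 * t ^ 2 = (edges P Λ).card := by
      field_simp
    have e2 : (4 * ((P.card : ℝ) * (1 / t)) + (Λ.card : ℝ) ^ 2 * (1 / t) ^ 4) * t ^ 2
        = 4 * P.card * t + (Λ.card : ℝ) ^ 2 / t ^ 2 := by
      field_simp
    rw [e1, e2] at h4
    exact h4
  linarith

/-- There are few lines containing more than `w` points. -/
theorem card_rich_le (P Λ : Finset (ℝ × ℝ)) {w : ℕ} (hw : 1 ≤ w)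
    (hΛ : ∀ l ∈ Λ, w + 1 ≤ (ptsOn P l).card) :
    (Λ.card : ℝ) ≤ 8 * P.card / w + 128 * (P.card : ℝ) ^ 2 / w ^ 3 := by
  have hw0 : (0 : ℝ) < w := by exact_mod_cast hw
  set n : ℝ := (P.card : ℝ) with hn
  set k : ℝ := (Λ.card : ℝ) with hk
  have hn0 : 0 ≤ n := by positivity
  have hk0 : 0 ≤ k := by positivity
  by_cases hsmall : k ≤ 8 * n / w
  · have : 0 ≤ 128 * n ^ 2 / w ^ 3 := by positivity
    linarith
  push Not at hsmall
  have hkpos : 0 < k := lt_of_le_of_lt (by positivity) hsmall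
  have hnpos : 0 < n := by
    rcases hn0.lt_or_eq with h | h
    · exact h
    · exfalso
      obtain ⟨l, hl⟩ := Finset.card_pos.1 (by rw [hk] at hkpos; exact_mod_cast hkpos)
      have h1 := hΛ l hl
      have h2 : (ptsOn P l).card ≤ P.card := Finset.card_filter_le _ _
      have h3 : P.card = 0 := by rw [hn] at h; exact_mod_cast h.symm
      omega
  rw [div_lt_iff₀ hw0] at hsmall
  have ht : 1 ≤ k * w / (8 * n) := by
    rw [le_div_iff₀ (by positivity)]; linarith
  have h1 := szemeredi_trotter P Λ ht
  have h2 : k * (w + 1) ≤ ∑ l ∈ Λ, ((ptsOn P l).card : ℝ) := by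
    have := Finset.card_nsmul_le_sum Λ (fun l => ((ptsOn P l).card : ℝ)) (w + 1) fun l hl => by
      exact_mod_cast hΛ l hl
    rwa [nsmul_eq_mul] at this
  have e1 : 4 * n * (k * w / (8 * n)) = k * w / 2 := by field_simp; norm_num
  have e2 : k ^ 2 / (k * w / (8 * n)) ^ 2 = 64 * n ^ 2 / w ^ 2 := by field_simp; norm_num
  rw [e1, e2] at h1
  have h3 : k * w ≤ 128 * n ^ 2 / w ^ 2 := by
    have : 64 * n ^ 2 / w ^ 2 * 2 = 128 * n ^ 2 / w ^ 2 := by ring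
    linarith
  have h4 : k ≤ 128 * n ^ 2 / w ^ 3 := by
    rw [le_div_iff₀ (by positivity)] at h3 ⊢
    nlinarith
  have : 0 ≤ 8 * n / w := by positivity
  linarith

/-- Slopes of the non-vertical lines joining `x` to other points of `X`. -/
noncomputable def slopesFrom (X : Finset (ℝ × ℝ)) (x : ℝ × ℝ) : Finset ℝ :=
  (X.filter fun y => y.1 ≠ x.1).image fun y => (x.2 - y.2) / (x.1 - y.1)

/-- The line through two points with different abscissae. -/
noncomputable def lineThrough (p q : ℝ × ℝ) : ℝ × ℝ :=
  ((p.2 - q.2) / (p.1 - q.1), p.2 - (p.2 - q.2) / (p.1 - q.1) * p.1)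

lemma lineThrough_left (p q : ℝ × ℝ) : p.2 = lineAt (lineThrough p q) p.1 := by
  simp [lineThrough, lineAt]

lemma lineThrough_right {p q : ℝ × ℝ} (h : p.1 ≠ q.1) : q.2 = lineAt (lineThrough p q) q.1 := by
  have : p.1 - q.1 ≠ 0 := sub_ne_zero.2 h
  simp only [lineThrough, lineAt]
  field_simp
  ring

/-- Non-vertical lines spanned by `X`. -/
noncomputable def spannedLines (X : Finset (ℝ × ℝ)) : Finset (ℝ × ℝ) :=
  ((X ×ˢ X).filter fun q => q.1.1 ≠ q.2.1).image fun q => lineThrough q.1 q.2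

lemma fst_ne_of_mem_ptsOn {X : Finset (ℝ × ℝ)} {l p q : ℝ × ℝ} (hp : p ∈ ptsOn X l)
    (hq : q ∈ ptsOn X l) (hpq : p ≠ q) : p.1 ≠ q.1 := by
  intro h
  rw [mem_ptsOn] at hp hq
  exact hpq (Prod.ext h (by rw [hp.2, hq.2, h]))

lemma exists_two_of_mem_spannedLines {X : Finset (ℝ × ℝ)} {l : ℝ × ℝ} (hl : l ∈ spannedLines X) :
    ∃ p ∈ ptsOn X l, ∃ q ∈ ptsOn X l, p.1 ≠ q.1 := by
  obtain ⟨⟨p, q⟩, hpq, rfl⟩ := Finset.mem_image.1 hl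
  obtain ⟨h1, h2⟩ := Finset.mem_filter.1 hpq
  obtain ⟨hp, hq⟩ := Finset.mem_product.1 h1
  exact ⟨p, mem_ptsOn.2 ⟨hp, lineThrough_left p q⟩, q, mem_ptsOn.2 ⟨hq, lineThrough_right h2⟩, h2⟩

lemma two_le_card_of_mem_spannedLines {X : Finset (ℝ × ℝ)} {l : ℝ × ℝ}
    (hl : l ∈ spannedLines X) : 2 ≤ (ptsOn X l).card := by
  obtain ⟨p, hp, q, hq, hpq⟩ := exists_two_of_mem_spannedLines hl
  exact Finset.one_lt_card.2 ⟨p, hp, q, hq, fun h => hpq (h ▸ rfl)⟩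

lemma sum_card_ptsOn_spannedLines_le (X : Finset (ℝ × ℝ)) :
    ∑ l ∈ spannedLines X, (ptsOn X l).card ≤ ∑ x ∈ X, (slopesFrom X x).card := by
  have h := Finset.sum_card_bipartiteAbove_eq_sum_card_bipartiteBelow
    (s := spannedLines X) (t := X) fun l x => x.2 = lineAt l x.1
  simp only [Finset.bipartiteAbove, Finset.bipartiteBelow] at h
  simp only [ptsOn]
  rw [h]
  refine Finset.sum_le_sum fun x hx => ?_
  refine Finset.card_le_card_of_injOn Prod.fst (fun l hl => ?_) fun l hl l' hl' hll => ?_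
  · obtain ⟨hl1, hl2⟩ := Finset.mem_filter.1 hl
    have hxl : x ∈ ptsOn X l := mem_ptsOn.2 ⟨hx, hl2⟩
    obtain ⟨p, hp, q, hq, hpq⟩ := exists_two_of_mem_spannedLines hl1
    obtain ⟨y, hy, hyx⟩ : ∃ y ∈ ptsOn X l, y.1 ≠ x.1 := by
      by_cases hpx : p.1 = x.1
      · exact ⟨q, hq, fun h => hpq (hpx.trans h.symm)⟩
      · exact ⟨p, hp, hpx⟩
    obtain ⟨hyX, hyl⟩ := mem_ptsOn.1 hy
    refine Finset.mem_image.2 ⟨y, Finset.mem_filter.2 ⟨hyX, hyx⟩, ?_⟩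
    have : x.1 - y.1 ≠ 0 := sub_ne_zero.2 hyx.symm
    rw [div_eq_iff this, hl2, hyl]
    simp only [lineAt]
    ring
  · have h1 := (Finset.mem_filter.1 hl).2
    have h2 := (Finset.mem_filter.1 hl').2
    refine Prod.ext hll ?_
    simp only [lineAt] at h1 h2
    rw [hll] at h1
    linarith

lemma two_mul_sum_Icc_le (i : ℕ) : i * (i - 1) ≤ ∑ w ∈ Finset.Icc 1 (i - 1), 2 * w := by
  have h := Finset.sum_range_id_mul_two i
  have : ∑ w ∈ Finset.range i, w ≤ ∑ w ∈ Finset.Icc 1 (i - 1), w := by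
    rw [← Finset.sum_filter_ne_zero]
    refine Finset.sum_le_sum_of_subset fun w hw => ?_
    simp only [Finset.mem_filter, Finset.mem_range, Finset.mem_Icc] at hw ⊢
    omega
  rw [← Finset.mul_sum]
  linarith

lemma card_sq_le_sum_rich (X : Finset (ℝ × ℝ)) {k : ℕ}
    (hk : ∀ l, (ptsOn X l).card ≤ k) (hv : ∀ c, (X.filter fun p => p.1 = c).card ≤ k) :
    X.card ^ 2 ≤ X.card * k + ∑ w ∈ Finset.Icc 1 k,
      2 * w * ((spannedLines X).filter fun l => w + 1 ≤ (ptsOn X l).card).card := by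
  have h1 : X.card ^ 2 = ((X ×ˢ X).filter fun q => q.1.1 = q.2.1).card +
      ((X ×ˢ X).filter fun q => q.1.1 ≠ q.2.1).card := by
    rw [Finset.card_filter_add_card_filter_not, Finset.card_product, sq]
  have h2 : ((X ×ˢ X).filter fun q => q.1.1 = q.2.1).card ≤ X.card * k := by
    have h3 : ((X ×ˢ X).filter fun q => q.1.1 = q.2.1).card =
        ∑ x ∈ X, (((X ×ˢ X).filter fun q => q.1.1 = q.2.1).filter fun q => q.1 = x).card :=
      Finset.card_eq_sum_card_fiberwise fun q hq =>
        (Finset.mem_product.1 (Finset.mem_filter.1 hq).1).1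
    rw [h3, ← smul_eq_mul]
    refine Finset.sum_le_card_nsmul _ _ _ fun x _ => le_trans ?_ (hv x.1)
    refine Finset.card_le_card_of_injOn Prod.snd (fun q hq => ?_) fun q hq r hr h => ?_
    · simp only [Finset.coe_filter, Finset.mem_filter, Finset.mem_product, Set.mem_ofPred_eq] at hq ⊢
      refine ⟨hq.1.1.2, ?_⟩
      rw [← hq.2, hq.1.2]
    · exact Prod.ext ((Finset.mem_filter.1 hq).2.trans (Finset.mem_filter.1 hr).2.symm) h
  have h4 : ((X ×ˢ X).filter fun q => q.1.1 ≠ q.2.1).card ≤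
      ∑ l ∈ spannedLines X, (ptsOn X l).card * ((ptsOn X l).card - 1) := by
    rw [Finset.card_eq_sum_card_image (fun q : (ℝ × ℝ) × (ℝ × ℝ) => lineThrough q.1 q.2)]
    refine Finset.sum_le_sum fun l _ => ?_
    have : (ptsOn X l).card * ((ptsOn X l).card - 1) = (ptsOn X l).offDiag.card := by
      rw [Finset.offDiag_card, Nat.mul_sub_one]
    rw [this]
    refine Finset.card_le_card fun q hq => ?_
    simp only [Finset.mem_filter, Finset.mem_product] at hq
    obtain ⟨⟨⟨ha, hb⟩, hne⟩, rfl⟩ := hq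
    exact Finset.mem_offDiag.2 ⟨mem_ptsOn.2 ⟨ha, lineThrough_left _ _⟩,
      mem_ptsOn.2 ⟨hb, lineThrough_right hne⟩, fun h => hne (h ▸ rfl)⟩
  have h5 : ∑ l ∈ spannedLines X, (ptsOn X l).card * ((ptsOn X l).card - 1) ≤
      ∑ w ∈ Finset.Icc 1 k,
        2 * w * ((spannedLines X).filter fun l => w + 1 ≤ (ptsOn X l).card).card := by
    simp only [Finset.card_filter, Finset.mul_sum]
    rw [Finset.sum_comm]
    refine Finset.sum_le_sum fun l _ => (two_mul_sum_Icc_le _).trans ?_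
    have : ∀ w ∈ Finset.Icc 1 k, 2 * w * (if w + 1 ≤ (ptsOn X l).card then 1 else 0) =
        if w + 1 ≤ (ptsOn X l).card then 2 * w else 0 := by
      intro w _
      split_ifs <;> simp
    rw [Finset.sum_congr rfl this, ← Finset.sum_filter]
    refine Finset.sum_le_sum_of_subset fun w hw => ?_
    have := hk l
    simp only [Finset.mem_filter, Finset.mem_Icc] at hw ⊢
    omega
  omega

/-- A form of the theorem of Beck: a planar set without rich lines determines many directions from
its points. -/
theorem card_sq_le_sum_slopesFrom (X : Finset (ℝ × ℝ)) {k : ℕ}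
    (hk : ∀ l, (ptsOn X l).card ≤ k) (hv : ∀ c, (X.filter fun p => p.1 = c).card ≤ k)
    (hX : 68 * k ≤ X.card) :
    (X.card : ℝ) ^ 2 ≤ 2 ^ 23 * ∑ x ∈ X, ((slopesFrom X x).card : ℝ) := by
  set s : ℝ := (X.card : ℝ) with hs
  set J : ℝ := ∑ x ∈ X, ((slopesFrom X x).card : ℝ) with hJ
  obtain ⟨K, hK⟩ : ∃ K : ℕ, K = 2047 := ⟨_, rfl⟩
  have hs0 : 0 ≤ s := Nat.cast_nonneg _
  have hJ0 : 0 ≤ J := Finset.sum_nonneg fun _ _ => Nat.cast_nonneg _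
  have hXr : 68 * (k : ℝ) ≤ s := by
    have h := (Nat.cast_le (α := ℝ)).2 hX
    rwa [Nat.cast_mul, Nat.cast_ofNat] at h
  have h1 : s ^ 2 ≤ s * k + ∑ w ∈ Finset.Icc 1 k,
      2 * w * (((spannedLines X).filter fun l => w + 1 ≤ (ptsOn X l).card).card : ℝ) := by
    have := card_sq_le_sum_rich X hk hv
    rw [hs]
    exact_mod_cast this
  have hΛJ : ((spannedLines X).card : ℝ) ≤ J := by
    have h2 := sum_card_ptsOn_spannedLines_le X
    have h3 : (spannedLines X).card ≤ ∑ l ∈ spannedLines X, (ptsOn X l).card := by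
      rw [Finset.card_eq_sum_ones]
      exact Finset.sum_le_sum fun l hl => by
        have := two_le_card_of_mem_spannedLines hl
        omega
    rw [hJ]
    exact_mod_cast h3.trans h2
  clear_value s J
  have hterm : ∀ w ∈ Finset.Icc 1 k,
      2 * w * (((spannedLines X).filter fun l => w + 1 ≤ (ptsOn X l).card).card : ℝ) ≤
      (if w ∈ Finset.range (K + 1) then 2 * w * J else 0) + 16 * s +
        (if w ∈ Finset.Ioo K (k + 1) then 256 * s ^ 2 * ((w : ℝ) ^ 2)⁻¹ else 0) := by
    intro w hw
    rw [Finset.mem_Icc] at hw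
    by_cases hwK : w < K + 1
    · rw [if_pos (Finset.mem_range.2 hwK), if_neg (by simp; omega)]
      have : (((spannedLines X).filter fun l => w + 1 ≤ (ptsOn X l).card).card : ℝ) ≤ J :=
        le_trans (by exact_mod_cast Finset.card_filter_le _ _) hΛJ
      have := mul_le_mul_of_nonneg_left this (by positivity : (0 : ℝ) ≤ 2 * w)
      linarith
    · rw [if_neg (by simpa using hwK), if_pos (by simp; omega)]
      have hw0 : (0 : ℝ) < w := by exact_mod_cast hw.1
      have := card_rich_le X ((spannedLines X).filter fun l => w + 1 ≤ (ptsOn X l).card) hw.1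
        fun l hl => (Finset.mem_filter.1 hl).2
      rw [← hs] at this
      have := mul_le_mul_of_nonneg_left this (by positivity : (0 : ℝ) ≤ 2 * w)
      have e : 2 * (w : ℝ) * (8 * s / w + 128 * s ^ 2 / w ^ 3) =
          16 * s + 256 * s ^ 2 * ((w : ℝ) ^ 2)⁻¹ := by
        field_simp
        ring
      rw [e] at this
      linarith
  have h6 := h1.trans (add_le_add_right (Finset.sum_le_sum hterm) _)
  rw [Finset.sum_add_distrib, Finset.sum_add_distrib, ← Finset.sum_filter, ← Finset.sum_filter,
    Finset.sum_const, nsmul_eq_mul, Nat.card_Icc] at h6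
  have h7 : ∑ w ∈ (Finset.Icc 1 k).filter (· ∈ Finset.range (K + 1)), 2 * (w : ℝ) * J
      ≤ 2 ^ 22 * J := by
    have h8 : ∑ w ∈ (Finset.Icc 1 k).filter (· ∈ Finset.range (K + 1)), 2 * (w : ℝ) * J ≤
        ∑ w ∈ Finset.range (K + 1), 2 * (w : ℝ) * J :=
      Finset.sum_le_sum_of_subset_of_nonneg (fun w hw => (Finset.mem_filter.1 hw).2)
        fun w _ _ => by positivity
    refine h8.trans ?_
    rw [← Finset.sum_mul, ← Finset.mul_sum]
    have h9 : (∑ w ∈ Finset.range (K + 1), (w : ℝ)) * 2 = ((K : ℝ) + 1) * K := by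
      have := Finset.sum_range_id_mul_two (K + 1)
      rw [Nat.add_sub_cancel] at this
      rw [← Nat.cast_sum]
      exact_mod_cast this
    have hKr : (K : ℝ) = 2047 := by rw [hK]; norm_num
    rw [hKr] at h9
    nlinarith
  have h10 : ∑ w ∈ (Finset.Icc 1 k).filter (· ∈ Finset.Ioo K (k + 1)),
      256 * s ^ 2 * ((w : ℝ) ^ 2)⁻¹ ≤ s ^ 2 / 4 := by
    have h8 : ∑ w ∈ (Finset.Icc 1 k).filter (· ∈ Finset.Ioo K (k + 1)),
        256 * s ^ 2 * ((w : ℝ) ^ 2)⁻¹ ≤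
        ∑ w ∈ Finset.Ioo K (k + 1), 256 * s ^ 2 * ((w : ℝ) ^ 2)⁻¹ :=
      Finset.sum_le_sum_of_subset_of_nonneg (fun w hw => (Finset.mem_filter.1 hw).2)
        fun w _ _ => by positivity
    refine h8.trans ?_
    rw [← Finset.mul_sum]
    have h9 := sum_Ioo_inv_sq_le (α := ℝ) K (k + 1)
    have := mul_le_mul_of_nonneg_left h9 (by positivity : 0 ≤ 256 * s ^ 2)
    refine this.trans (le_of_eq ?_)
    have hKr : (K : ℝ) = 2047 := by rw [hK]; norm_num
    rw [hKr]
    ring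
  have h11 : s * k * 68 ≤ s ^ 2 := by nlinarith
  have h12 : ((k + 1 - 1 : ℕ) : ℝ) = k := by simp
  rw [h12] at h6
  nlinarith

/-- The relation `x ∘ y⁻¹ ∘ z = w` between the affine maps `t ↦ x.1 * t + x.2` etc. -/
def AffRel (x y z w : ℝ × ℝ) : Prop :=
  x.1 * z.1 = w.1 * y.1 ∧ x.1 * (z.2 - y.2) = y.1 * (w.2 - x.2)

/-- Quadruples `((x, z), (y, w))` with `x ∘ y⁻¹ ∘ z = w`. -/
noncomputable def affQuads (L : Finset (ℝ × ℝ)) :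
    Finset (((ℝ × ℝ) × (ℝ × ℝ)) × ((ℝ × ℝ) × (ℝ × ℝ))) :=
  ((L ×ˢ L) ×ˢ (L ×ˢ L)).filter fun q => AffRel q.1.1 q.2.1 q.1.2 q.2.2

/-- Those `x` that extend to a quadruple with the given `(y, w)`. -/
noncomputable def affLeft (L : Finset (ℝ × ℝ)) (r : (ℝ × ℝ) × (ℝ × ℝ)) : Finset (ℝ × ℝ) :=
  L.filter fun x => ∃ z ∈ L, AffRel x r.1 z r.2

/-- Those `y` that extend to a quadruple with the given `(x, z)`. -/
noncomputable def affMid (L : Finset (ℝ × ℝ)) (p : (ℝ × ℝ) × (ℝ × ℝ)) : Finset (ℝ × ℝ) :=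
  L.filter fun y => ∃ w ∈ L, AffRel p.1 y p.2 w

/-- Lines containing every `y` which extends to two quadruples `(x, y, z, w)`, `(x₁, y, z₁, w)`
with the given `(x, z)`. -/
noncomputable def affLines (L : Finset (ℝ × ℝ)) (p : (ℝ × ℝ) × (ℝ × ℝ)) : Finset (ℝ × ℝ) :=
  ((L ×ˢ L).filter fun r => r.1.1 * r.2.1 = p.1.1 * p.2.1).image fun r =>
    ((p.1.2 - r.1.2) / (p.1.1 - r.1.1), (p.1.1 * p.2.2 - r.1.1 * r.2.2) / (p.1.1 - r.1.1))

lemma mem_affQuads {L : Finset (ℝ × ℝ)} {q : ((ℝ × ℝ) × (ℝ × ℝ)) × ((ℝ × ℝ) × (ℝ × ℝ))} :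
    q ∈ affQuads L ↔ (q.1 ∈ L ×ˢ L ∧ q.2 ∈ L ×ˢ L) ∧ AffRel q.1.1 q.2.1 q.1.2 q.2.2 := by
  rw [affQuads, Finset.mem_filter, Finset.mem_product]

lemma AffRel.third_unique {x y z z' w : ℝ × ℝ} (hx : x.1 ≠ 0) (h : AffRel x y z w)
    (h' : AffRel x y z' w) : z = z' := by
  refine Prod.ext (mul_left_cancel₀ hx (h.1.trans h'.1.symm)) ?_
  have := mul_left_cancel₀ hx (h.2.trans h'.2.symm)
  linarith

lemma AffRel.fourth_unique {x y z w w' : ℝ × ℝ} (hy : y.1 ≠ 0) (h : AffRel x y z w)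
    (h' : AffRel x y z w') : w = w' := by
  refine Prod.ext (mul_right_cancel₀ hy (h.1.symm.trans h'.1)) ?_
  have := mul_left_cancel₀ hy (h.2.symm.trans h'.2)
  linarith

lemma sum_affQuads_left {L : Finset (ℝ × ℝ)} (h0 : ∀ l ∈ L, l.1 ≠ 0)
    (g : ℝ × ℝ → (ℝ × ℝ) × (ℝ × ℝ) → ℝ) :
    ∑ q ∈ affQuads L, g q.1.1 q.2 = ∑ r ∈ L ×ˢ L, ∑ x ∈ affLeft L r, g x r := by
  rw [← Finset.sum_fiberwise_of_maps_to (g := Prod.snd) (t := L ×ˢ L)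
    fun q hq => (mem_affQuads.1 hq).1.2]
  refine Finset.sum_congr rfl fun r hr => ?_
  refine Finset.sum_bij (fun q _ => q.1.1) (fun q hq => ?_) (fun q hq q' hq' h => ?_)
    (fun x hx => ?_) fun q hq => ?_
  · obtain ⟨hq1, rfl⟩ := Finset.mem_filter.1 hq
    obtain ⟨⟨h1, h2⟩, h3⟩ := mem_affQuads.1 hq1
    obtain ⟨h4, h5⟩ := Finset.mem_product.1 h1
    exact Finset.mem_filter.2 ⟨h4, _, h5, h3⟩
  · obtain ⟨hq1, rfl⟩ := Finset.mem_filter.1 hq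
    obtain ⟨hq', hr'⟩ := Finset.mem_filter.1 hq'
    obtain ⟨⟨h1, h2⟩, h3⟩ := mem_affQuads.1 hq1
    obtain ⟨-, h3'⟩ := mem_affQuads.1 hq'
    rw [hr', ← h] at h3'
    exact Prod.ext (Prod.ext h (h3.third_unique (h0 _ (Finset.mem_product.1 h1).1) h3')) hr'.symm
  · obtain ⟨hx, z, hz, hrel⟩ := Finset.mem_filter.1 hx
    exact ⟨((x, z), r), Finset.mem_filter.2 ⟨mem_affQuads.2
      ⟨⟨Finset.mem_product.2 ⟨hx, hz⟩, hr⟩, hrel⟩, rfl⟩, rfl⟩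
  · rw [(Finset.mem_filter.1 hq).2]

lemma sum_affQuads_mid {L : Finset (ℝ × ℝ)} (h0 : ∀ l ∈ L, l.1 ≠ 0)
    (g : (ℝ × ℝ) × (ℝ × ℝ) → ℝ × ℝ → ℝ) :
    ∑ q ∈ affQuads L, g q.1 q.2.1 = ∑ p ∈ L ×ˢ L, ∑ y ∈ affMid L p, g p y := by
  rw [← Finset.sum_fiberwise_of_maps_to (g := Prod.fst) (t := L ×ˢ L)
    fun q hq => (mem_affQuads.1 hq).1.1]
  refine Finset.sum_congr rfl fun p hp => ?_
  refine Finset.sum_bij (fun q _ => q.2.1) (fun q hq => ?_) (fun q hq q' hq' h => ?_)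
    (fun y hy => ?_) fun q hq => ?_
  · obtain ⟨hq1, rfl⟩ := Finset.mem_filter.1 hq
    obtain ⟨⟨h1, h2⟩, h3⟩ := mem_affQuads.1 hq1
    obtain ⟨h4, h5⟩ := Finset.mem_product.1 h2
    exact Finset.mem_filter.2 ⟨h4, _, h5, h3⟩
  · obtain ⟨hq1, rfl⟩ := Finset.mem_filter.1 hq
    obtain ⟨hq', hr'⟩ := Finset.mem_filter.1 hq'
    obtain ⟨⟨h1, h2⟩, h3⟩ := mem_affQuads.1 hq1
    obtain ⟨-, h3'⟩ := mem_affQuads.1 hq'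
    rw [hr', ← h] at h3'
    exact Prod.ext hr'.symm (Prod.ext h (h3.fourth_unique (h0 _ (Finset.mem_product.1 h2).1) h3'))
  · obtain ⟨hy, w, hw, hrel⟩ := Finset.mem_filter.1 hy
    exact ⟨(p, (y, w)), Finset.mem_filter.2 ⟨mem_affQuads.2
      ⟨⟨hp, Finset.mem_product.2 ⟨hy, hw⟩⟩, hrel⟩, rfl⟩, rfl⟩
  · rw [(Finset.mem_filter.1 hq).2]

lemma card_slopesFrom_affLeft_le {L : Finset (ℝ × ℝ)}
    {q : ((ℝ × ℝ) × (ℝ × ℝ)) × ((ℝ × ℝ) × (ℝ × ℝ))} (hq : q ∈ affQuads L) :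
    (slopesFrom (affLeft L q.2) q.1.1).card ≤
      ((affLines L q.1).filter fun l => q.2.1.2 = lineAt l q.2.1.1).card := by
  obtain ⟨⟨x, z⟩, y, w⟩ := q
  obtain ⟨⟨h1, h2⟩, h3⟩ := mem_affQuads.1 hq
  refine le_trans (Finset.card_le_card fun s hs => ?_)
    (Finset.card_image_le (f := (Prod.fst : ℝ × ℝ → ℝ)))
  obtain ⟨x', hx', rfl⟩ := Finset.mem_image.1 hs
  obtain ⟨hx', hne⟩ := Finset.mem_filter.1 hx'
  obtain ⟨hx', z', hz', h4⟩ := Finset.mem_filter.1 hx'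
  refine Finset.mem_image.2 ⟨_, Finset.mem_filter.2 ⟨Finset.mem_image.2 ⟨(x', z'),
    Finset.mem_filter.2 ⟨Finset.mem_product.2 ⟨hx', hz'⟩, ?_⟩, rfl⟩, ?_⟩, rfl⟩
  · exact h4.1.trans h3.1.symm
  · have : x.1 - x'.1 ≠ 0 := sub_ne_zero.2 (Ne.symm hne)
    have h5 := h3.2
    have h6 := h4.2
    simp only [lineAt] at h5 h6 ⊢
    field_simp
    linarith

lemma card_affLines_le {L : Finset (ℝ × ℝ)} (h0 : ∀ l ∈ L, l.1 ≠ 0) {m : ℕ}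
    (hm : ∀ c, (L.filter fun p => p.1 = c).card ≤ m) (p : (ℝ × ℝ) × (ℝ × ℝ)) :
    (affLines L p).card ≤ L.card * m := by
  refine Finset.card_image_le.trans ?_
  rw [Finset.card_eq_sum_card_fiberwise (f := Prod.fst) (t := L)
    fun r hr => (Finset.mem_product.1 (Finset.mem_filter.1 hr).1).1, ← smul_eq_mul]
  refine Finset.sum_le_card_nsmul _ _ _ fun x hx => le_trans ?_ (hm (p.1.1 * p.2.1 / x.1))
  refine Finset.card_le_card_of_injOn Prod.snd (fun q hq => ?_) fun q hq r hr h => ?_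
  · simp only [Finset.coe_filter, Finset.mem_filter, Finset.mem_product, Set.mem_ofPred_eq] at hq ⊢
    refine ⟨hq.1.1.2, ?_⟩
    have h := hq.1.2
    simp only [hq.2, smul_eq_mul] at h
    rw [eq_div_iff (h0 x hx), mul_comm, h]
  · exact Prod.ext ((Finset.mem_filter.1 hq).2.trans (Finset.mem_filter.1 hr).2.symm) h

lemma sum_card_slopesFrom_affLeft_le {L : Finset (ℝ × ℝ)} (h0 : ∀ l ∈ L, l.1 ≠ 0) {m : ℕ}
    (hm : ∀ c, (L.filter fun p => p.1 = c).card ≤ m) {t : ℝ} (ht : 1 ≤ t) :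
    ∑ q ∈ affQuads L, ((slopesFrom (affLeft L q.2) q.1.1).card : ℝ) ≤
      (L.card : ℝ) ^ 2 * (L.card * m) + 4 * (affQuads L).card * t +
        (L.card : ℝ) ^ 2 * (L.card * m) ^ 2 / t ^ 2 := by
  have h1 : ∑ q ∈ affQuads L, ((slopesFrom (affLeft L q.2) q.1.1).card : ℝ) ≤
      ∑ q ∈ affQuads L, (((affLines L q.1).filter fun l => q.2.1.2 = lineAt l q.2.1.1).card : ℝ) :=
    Finset.sum_le_sum fun q hq => by exact_mod_cast card_slopesFrom_affLeft_le hq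
  refine h1.trans ?_
  rw [sum_affQuads_mid h0 fun p y => (((affLines L p).filter fun l => y.2 = lineAt l y.1).card : ℝ)]
  have h2 : ((affQuads L).card : ℝ) = ∑ p ∈ L ×ˢ L, ((affMid L p).card : ℝ) := by
    have := sum_affQuads_mid h0 fun _ _ => 1
    simpa using this
  have h3 : ∀ p ∈ L ×ˢ L,
      ∑ y ∈ affMid L p, (((affLines L p).filter fun l => y.2 = lineAt l y.1).card : ℝ) ≤
        L.card * m + 4 * (affMid L p).card * t + (L.card * m) ^ 2 / t ^ 2 := by
    intro p _
    have h4 := Finset.sum_card_bipartiteAbove_eq_sum_card_bipartiteBelow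
      (s := affLines L p) (t := affMid L p) fun l x => x.2 = lineAt l x.1
    simp only [Finset.bipartiteAbove, Finset.bipartiteBelow] at h4
    have h5 := szemeredi_trotter (affMid L p) (affLines L p) ht
    simp only [ptsOn] at h5
    have h6 : ((affLines L p).card : ℝ) ≤ L.card * m := by
      exact_mod_cast card_affLines_le h0 hm p
    rw [← Nat.cast_sum, ← h4, Nat.cast_sum]
    refine h5.trans ?_
    gcongr
  refine (Finset.sum_le_sum h3).trans (le_of_eq ?_)
  rw [Finset.sum_add_distrib, Finset.sum_add_distrib, Finset.sum_const, Finset.sum_const, h2,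
    Finset.card_product, nsmul_eq_mul, nsmul_eq_mul, ← Finset.sum_mul, ← Finset.mul_sum]
  push_cast
  ring

lemma card_affQuads_eq {L : Finset (ℝ × ℝ)} (h0 : ∀ l ∈ L, l.1 ≠ 0) :
    ((affQuads L).card : ℝ) = ∑ r ∈ L ×ˢ L, ((affLeft L r).card : ℝ) := by
  have := sum_affQuads_left h0 fun _ _ => 1
  simpa using this

lemma affQuads_card_le_of_rich {L : Finset (ℝ × ℝ)} (h0 : ∀ l ∈ L, l.1 ≠ 0) {k : ℕ}
    (hk : ∀ l, (ptsOn L l).card ≤ k) (hv : ∀ c, (L.filter fun p => p.1 = c).card ≤ k)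
    (hE : 136 * (k : ℝ) * (L.card : ℝ) ^ 2 ≤ (affQuads L).card) :
    ((affQuads L).card : ℝ) ^ 2 ≤ 2 ^ 25 * (L.card : ℝ) ^ 2 *
      ∑ q ∈ affQuads L, ((slopesFrom (affLeft L q.2) q.1.1).card : ℝ) := by
  set R := (L ×ˢ L).filter fun r => 68 * k ≤ (affLeft L r).card with hR
  have h1 : ((affQuads L).card : ℝ) ≤
      68 * k * (L.card : ℝ) ^ 2 + ∑ r ∈ R, ((affLeft L r).card : ℝ) := by
    rw [card_affQuads_eq h0, ← Finset.sum_filter_add_sum_filter_not (L ×ˢ L)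
      fun r => 68 * k ≤ (affLeft L r).card, add_comm]
    gcongr
    have h2 : ∀ r ∈ (L ×ˢ L).filter fun r => ¬ 68 * k ≤ (affLeft L r).card,
        ((affLeft L r).card : ℝ) ≤ 68 * k := by
      intro r hr
      have := (Finset.mem_filter.1 hr).2
      push Not at this
      exact_mod_cast this.le
    refine (Finset.sum_le_card_nsmul _ _ _ h2).trans ?_
    rw [nsmul_eq_mul, mul_comm]
    gcongr
    rw [sq]
    exact_mod_cast (Finset.card_filter_le _ _).trans (Finset.card_product L L).le
  have h3 : (∑ r ∈ R, ((affLeft L r).card : ℝ)) ^ 2 ≤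
      (L.card : ℝ) ^ 2 * ∑ r ∈ R, ((affLeft L r).card : ℝ) ^ 2 := by
    refine sq_sum_le_card_mul_sum_sq.trans
      (mul_le_mul_of_nonneg_right ?_ (Finset.sum_nonneg fun _ _ => sq_nonneg _))
    rw [sq]
    exact_mod_cast (Finset.card_filter_le _ _).trans (Finset.card_product L L).le
  have h4 : ∑ r ∈ R, ((affLeft L r).card : ℝ) ^ 2 ≤
      (2 : ℝ) ^ 23 * ∑ q ∈ affQuads L, ((slopesFrom (affLeft L q.2) q.1.1).card : ℝ) := by
    rw [sum_affQuads_left h0 fun x r => ((slopesFrom (affLeft L r) x).card : ℝ), Finset.mul_sum]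
    refine le_trans (Finset.sum_le_sum fun r hr => ?_)
      (Finset.sum_le_sum_of_subset_of_nonneg (Finset.filter_subset _ _) fun r _ _ =>
        mul_nonneg (by norm_num) (Finset.sum_nonneg fun _ _ => Nat.cast_nonneg _))
    have hsub : affLeft L r ⊆ L := Finset.filter_subset _ _
    refine card_sq_le_sum_slopesFrom _ (fun l => le_trans (Finset.card_le_card ?_) (hk l))
      (fun c => le_trans (Finset.card_le_card ?_) (hv c)) (Finset.mem_filter.1 hr).2
    · exact Finset.filter_subset_filter _ hsub
    · exact Finset.filter_subset_filter _ hsub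
  generalize ∑ q ∈ affQuads L, ((slopesFrom (affLeft L q.2) q.1.1).card : ℝ) = S at *
  generalize ∑ r ∈ R, ((affLeft L r).card : ℝ) ^ 2 = U at *
  generalize ∑ r ∈ R, ((affLeft L r).card : ℝ) = V at *
  generalize hE' : ((affQuads L).card : ℝ) = E at *
  have hE0 : 0 ≤ E := hE' ▸ Nat.cast_nonneg _
  have h5 : E ≤ 2 * V := by linarith
  have h6 : E ^ 2 ≤ 4 * V ^ 2 := by nlinarith
  have h7 := mul_le_mul_of_nonneg_left h4 (sq_nonneg (L.card : ℝ))
  linarith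

/-- A dichotomy for the energy of a set of affine maps of which at most `m` are parallel and at
most `M` agree at a point. -/
theorem card_affQuads_dichotomy {L : Finset (ℝ × ℝ)} (h0 : ∀ l ∈ L, l.1 ≠ 0) {m M : ℕ}
    (hm1 : 1 ≤ m) (hmL : m ≤ L.card) (hm : ∀ c, (L.filter fun p => p.1 = c).card ≤ m)
    (hM : ∀ l, (ptsOn L l).card ≤ M) :
    ((affQuads L).card : ℝ) ^ 2 ≤ 2 ^ 56 * (L.card : ℝ) ^ 5 * m ∨
      ((affQuads L).card : ℝ) ≤ 2 ^ 28 * M * (L.card : ℝ) ^ 2 := by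
  set k := max m M with hk
  have hmr : (1 : ℝ) ≤ m := by exact_mod_cast hm1
  have hkm : (m : ℝ) ≤ k := by exact_mod_cast le_max_left m M
  have hmN : (m : ℝ) ≤ L.card := by exact_mod_cast hmL
  suffices ((affQuads L).card : ℝ) ^ 2 ≤ 2 ^ 42 * (L.card : ℝ) ^ 5 * m ∨
      ((affQuads L).card : ℝ) ≤ 2 ^ 28 * k * (L.card : ℝ) ^ 2 by
    rcases this with h | h
    · left
      refine h.trans ?_
      gcongr <;> norm_num
    · rcases max_choice m M with h1 | h1
      · left
        rw [hk, h1] at h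
        calc ((affQuads L).card : ℝ) ^ 2 ≤ (2 ^ 28 * m * (L.card : ℝ) ^ 2) ^ 2 := by gcongr
          _ = 2 ^ 56 * (L.card : ℝ) ^ 4 * m * m := by ring
          _ ≤ 2 ^ 56 * (L.card : ℝ) ^ 4 * m * L.card := by gcongr
          _ = _ := by ring
      · right
        rwa [hk, h1] at h
  by_contra hcon
  push Not at hcon
  obtain ⟨hc1, hc2⟩ := hcon
  have h1 := affQuads_card_le_of_rich h0 (k := k) (fun l => (hM l).trans (le_max_right _ _))
    (fun c => (hm c).trans (le_max_left _ _)) (le_trans (by gcongr; norm_num) hc2.le)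
  have h2 : ∀ t : ℝ, 1 ≤ t → _ := fun t ht => sum_card_slopesFrom_affLeft_le h0 hm ht
  generalize ∑ q ∈ affQuads L, ((slopesFrom (affLeft L q.2) q.1.1).card : ℝ) = S at *
  generalize ((affQuads L).card : ℝ) = E at *
  generalize (L.card : ℝ) = N at *
  generalize (m : ℝ) = μ at *
  generalize (k : ℝ) = κ at *
  have hN : 1 ≤ N := hmr.trans hmN
  have hE : 2 ^ 28 * N ^ 2 ≤ E := by
    refine le_trans ?_ hc2.le
    have : 1 ≤ κ := hmr.trans hkm
    have := mul_le_mul_of_nonneg_left this (by positivity : 0 ≤ 2 ^ 28 * N ^ 2)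
    linarith
  have hE0 : 0 < E := lt_of_lt_of_le (by positivity) hE
  have h3 := h2 (E / (2 ^ 28 * N ^ 2)) (by rwa [one_le_div (by positivity)])
  have h4 := h1.trans (mul_le_mul_of_nonneg_left h3 (by positivity))
  have e : 2 ^ 25 * N ^ 2 * (N ^ 2 * (N * μ) + 4 * E * (E / (2 ^ 28 * N ^ 2)) +
      N ^ 2 * (N * μ) ^ 2 / (E / (2 ^ 28 * N ^ 2)) ^ 2) =
      2 ^ 25 * (N ^ 5 * μ) + E ^ 2 / 2 + 2 ^ 81 * (N ^ 5 * μ) ^ 2 / E ^ 2 := by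
    field_simp
    ring
  rw [e] at h4
  have hG : 0 < N ^ 5 * μ := by positivity
  generalize hG' : N ^ 5 * μ = G at *
  rw [mul_assoc, hG'] at hc1
  have h5 : 2 ^ 81 * G ^ 2 / E ^ 2 ≤ 2 ^ 39 * G := by
    rw [div_le_iff₀ (by positivity)]
    nlinarith
  linarith

lemma card_filter_eq_eq_sum {α β γ : Type*} [DecidableEq γ] (S : Finset α) (T : Finset β)
    (f : α → γ) (g : β → γ) {U : Finset γ} (hU : ∀ s ∈ S, f s ∈ U) :
    ((S ×ˢ T).filter fun q => f q.1 = g q.2).card =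
      ∑ c ∈ U, (S.filter fun s => f s = c).card * (T.filter fun t => g t = c).card := by
  rw [Finset.card_eq_sum_card_fiberwise (f := fun q => f q.1) (t := U)]
  · refine Finset.sum_congr rfl fun c _ => ?_
    rw [← Finset.card_product]
    congr 1
    ext ⟨s, t⟩
    simp only [Finset.mem_filter, Finset.mem_product]
    constructor
    · rintro ⟨⟨⟨hs, ht⟩, h1⟩, h2⟩
      exact ⟨⟨hs, h2⟩, ht, h1 ▸ h2⟩
    · rintro ⟨⟨hs, h1⟩, ht, h2⟩
      exact ⟨⟨⟨hs, ht⟩, h1.trans h2.symm⟩, h1⟩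
  · intro q hq
    exact hU _ (Finset.mem_product.1 (Finset.mem_filter.1 hq).1).1

lemma card_filter_eq_sq_le {α β γ : Type*} [DecidableEq γ] (S : Finset α) (T : Finset β)
    (f : α → γ) (g : β → γ) :
    ((S ×ˢ T).filter fun q => f q.1 = g q.2).card ^ 2 ≤
      ((S ×ˢ S).filter fun q => f q.1 = f q.2).card *
        ((T ×ˢ T).filter fun q => g q.1 = g q.2).card := by
  have hS : ∀ s ∈ S, f s ∈ S.image f ∪ T.image g := fun s hs =>
    Finset.mem_union_left _ (Finset.mem_image_of_mem _ hs)
  have hT : ∀ t ∈ T, g t ∈ S.image f ∪ T.image g := fun s hs =>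
    Finset.mem_union_right _ (Finset.mem_image_of_mem _ hs)
  rw [card_filter_eq_eq_sum S T f g hS, card_filter_eq_eq_sum S S f f hS,
    card_filter_eq_eq_sum T T g g hT]
  simp only [← sq]
  exact Finset.sum_mul_sq_le_sq_mul_sq _ _ _

lemma card_mul_sq_le {ι : Type*} {s : Finset ι} {P : ι → Finset (ℝ × ℝ)} {k : ℕ}
    (hP : ∀ i ∈ s, k ≤ (P i).card)
    (hdisj : ∀ i ∈ s, ∀ j ∈ s, ∀ p, p ∈ P i → p ∈ P j → i = j)
    {Q : Finset ((ℝ × ℝ) × (ℝ × ℝ))}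
    (hQ : ∀ i ∈ s, ∀ p ∈ P i, ∀ p' ∈ P i, ((p.1, p'.1), (p.2, p'.2)) ∈ Q) :
    s.card * k ^ 2 ≤ Q.card := by
  have h1 : s.card * k ^ 2 ≤ (s.sigma fun i => P i ×ˢ P i).card := by
    rw [Finset.card_sigma, ← smul_eq_mul]
    refine Finset.card_nsmul_le_sum _ _ _ fun i hi => ?_
    rw [Finset.card_product, sq]
    exact Nat.mul_le_mul (hP i hi) (hP i hi)
  refine h1.trans ?_
  refine Finset.card_le_card_of_injOn (fun x => ((x.2.1.1, x.2.2.1), (x.2.1.2, x.2.2.2)))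
    (fun x hx => ?_) ?_
  · obtain ⟨hi, hp⟩ := Finset.mem_sigma.1 hx
    exact hQ _ hi _ (Finset.mem_product.1 hp).1 _ (Finset.mem_product.1 hp).2
  · rintro ⟨i, p, p'⟩ hx ⟨j, r, r'⟩ hy h
    obtain ⟨hi, hp⟩ := Finset.mem_sigma.1 hx
    obtain ⟨hj, hr⟩ := Finset.mem_sigma.1 hy
    simp only [Prod.mk.injEq] at h
    have e1 : p = r := Prod.ext h.1.1 h.2.1
    have e2 : p' = r' := Prod.ext h.1.2 h.2.2
    subst e1 e2
    obtain rfl := hdisj i hi j hj p (Finset.mem_product.1 hp).1 (Finset.mem_product.1 hr).1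
    rfl

lemma card_sub_eq_sub_le_addE (A : Finset ℝ) {c : ℝ} (hc : c ≠ 0) :
    (((A ×ˢ A) ×ˢ (A ×ˢ A)).filter fun q => c * (q.1.1 - q.1.2) = c * (q.2.1 - q.2.2)).card ≤
      addE ℝ A A := by
  refine Finset.card_le_card_of_injOn (fun q => ((q.1.1, q.2.1), (q.1.2, q.2.2)))
    (fun q hq => ?_) ?_
  · simp only [Finset.coe_filter, Finset.mem_product, Set.mem_ofPred_eq] at hq ⊢
    exact ⟨⟨⟨hq.1.1.1, hq.1.2.1⟩, hq.1.1.2, hq.1.2.2⟩, mul_left_cancel₀ hc hq.2⟩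
  · rintro ⟨⟨a, b⟩, c, d⟩ - ⟨⟨a', b'⟩, c', d'⟩ - h
    simp only [Prod.mk.injEq] at h ⊢
    tauto

/-- Few lines of the same slope are rich. -/
lemma card_parallel_le (A B : Finset ℝ) {w : ℕ} {c : ℝ} (hc : c ≠ 0) {L : Finset (ℝ × ℝ)}
    (hL : ∀ l ∈ L, l.1 = c) (hw : ∀ l ∈ L, w ≤ (ptsOn (A ×ˢ B) l).card) :
    (L.card * w ^ 2) ^ 2 ≤ addE ℝ A A * addE ℝ B B := by
  have h1 : L.card * w ^ 2 ≤ (((A ×ˢ A) ×ˢ (B ×ˢ B)).filter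
      fun q => c * (q.1.1 - q.1.2) = 1 * (q.2.1 - q.2.2)).card := by
    refine card_mul_sq_le hw (fun l hl l' hl' p hp hp' => ?_) fun l hl p hp p' hp' => ?_
    · have h2 := (mem_ptsOn.1 hp).2
      have h3 := (mem_ptsOn.1 hp').2
      simp only [lineAt] at h2 h3
      refine Prod.ext ((hL l hl).trans (hL l' hl').symm) ?_
      rw [hL l hl] at h2
      rw [hL l' hl'] at h3
      linarith
    · obtain ⟨h2, h3⟩ := mem_ptsOn.1 hp
      obtain ⟨h4, h5⟩ := mem_ptsOn.1 hp'
      rw [Finset.mem_product] at h2 h4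
      simp only [Finset.mem_filter, Finset.mem_product, lineAt] at h3 h5 ⊢
      rw [hL l hl] at h3 h5
      refine ⟨⟨⟨h2.1, h4.1⟩, h2.2, h4.2⟩, ?_⟩
      linarith
  exact (Nat.pow_le_pow_left h1 2).trans ((card_filter_eq_sq_le (A ×ˢ A) (B ×ˢ B)
    (fun s => c * (s.1 - s.2)) fun s => 1 * (s.1 - s.2)).trans
    (Nat.mul_le_mul (card_sub_eq_sub_le_addE A hc) (card_sub_eq_sub_le_addE B one_ne_zero)))

lemma mulE_le_mulEbar (A : Finset ℝ) (s : ℝ) :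
    mulE ℝ (A.image fun a => a - s) (A.image fun a => a - s) ≤ mulEbar ℝ A := by
  refine le_ciSup (f := fun s => mulE ℝ (A.image fun a => a - s) (A.image fun a => a - s))
    ⟨A.card * A.card * (A.card * A.card), ?_⟩ s
  rintro _ ⟨s, rfl⟩
  refine (Finset.card_filter_le _ _).trans ?_
  rw [Finset.card_product, Finset.card_product]
  have h : (A.image fun a => a - s).card ≤ A.card := Finset.card_image_le
  exact Nat.mul_le_mul (Nat.mul_le_mul h h) (Nat.mul_le_mul h h)

lemma card_div_eq_div_le_mulEbar (A : Finset ℝ) (u : ℝ) :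
    ((((A.erase u) ×ˢ (A.erase u)) ×ˢ ((A.erase u) ×ˢ (A.erase u))).filter fun q =>
      (q.1.1 - u) / (q.1.2 - u) = (q.2.1 - u) / (q.2.2 - u)).card ≤ mulEbar ℝ A := by
  refine le_trans ?_ (mulE_le_mulEbar A u)
  refine Finset.card_le_card_of_injOn
    (fun q => ((q.1.1 - u, q.2.1 - u), (q.1.2 - u, q.2.2 - u))) (fun q hq => ?_) ?_
  · simp only [Finset.coe_filter, Finset.mem_product, Set.mem_ofPred_eq,
      Finset.mem_erase] at hq ⊢
    obtain ⟨⟨⟨⟨h1, h2⟩, h3, h4⟩, ⟨h5, h6⟩, h7, h8⟩, h9⟩ := hq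
    rw [div_eq_div_iff (sub_ne_zero.2 h3) (sub_ne_zero.2 h7)] at h9
    exact ⟨⟨⟨Finset.mem_image_of_mem _ h2, Finset.mem_image_of_mem _ h6⟩,
      Finset.mem_image_of_mem _ h4, Finset.mem_image_of_mem _ h8⟩, h9⟩
  · rintro ⟨⟨a, b⟩, c, d⟩ - ⟨⟨a', b'⟩, c', d'⟩ - h
    simp only [Prod.mk.injEq, sub_left_inj] at h ⊢
    tauto

/-- Few lines through a given point are rich. -/
lemma card_concurrent_le (A B : Finset ℝ) {w : ℕ} {u v : ℝ} {L : Finset (ℝ × ℝ)}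
    (h0 : ∀ l ∈ L, l.1 ≠ 0) (hL : ∀ l ∈ L, v = lineAt l u)
    (hw : ∀ l ∈ L, w + 1 ≤ (ptsOn (A ×ˢ B) l).card) :
    (L.card * w ^ 2) ^ 2 ≤ mulEbar ℝ A * mulEbar ℝ B := by
  have hslope : ∀ l ∈ L, ∀ p ∈ (ptsOn (A ×ˢ B) l).erase (u, v),
      (p.1 ∈ A.erase u ∧ p.2 ∈ B.erase v) ∧ p.2 - v = l.1 * (p.1 - u) := by
    intro l hl p hp
    obtain ⟨hne, hp⟩ := Finset.mem_erase.1 hp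
    obtain ⟨h2, h3⟩ := mem_ptsOn.1 hp
    rw [Finset.mem_product] at h2
    have h4 := hL l hl
    have h5 : p.2 - v = l.1 * (p.1 - u) := by
      rw [h3, h4]
      simp only [lineAt]
      ring
    have h6 : p.1 ≠ u := by
      intro h
      refine hne (Prod.ext h ?_)
      rw [h, sub_self, mul_zero] at h5
      exact sub_eq_zero.1 h5
    refine ⟨⟨Finset.mem_erase.2 ⟨h6, h2.1⟩, Finset.mem_erase.2 ⟨fun h => ?_, h2.2⟩⟩, h5⟩
    rw [h, sub_self] at h5
    exact mul_ne_zero (h0 l hl) (sub_ne_zero.2 h6) h5.symm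
  have h1 : L.card * w ^ 2 ≤ ((((A.erase u) ×ˢ (A.erase u)) ×ˢ ((B.erase v) ×ˢ (B.erase v))).filter
      fun q => (q.1.1 - u) / (q.1.2 - u) = (q.2.1 - v) / (q.2.2 - v)).card := by
    refine card_mul_sq_le (P := fun l => (ptsOn (A ×ˢ B) l).erase (u, v)) (fun l hl => ?_)
      (fun l hl l' hl' p hp hp' => ?_) fun l hl p hp p' hp' => ?_
    · have := hw l hl
      have := Finset.pred_card_le_card_erase (s := ptsOn (A ×ˢ B) l) (a := (u, v))
      omega
    · obtain ⟨⟨h2, -⟩, h3⟩ := hslope l hl p hp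
      obtain ⟨-, h4⟩ := hslope l' hl' p hp'
      have h5 : l.1 = l'.1 := mul_right_cancel₀ (sub_ne_zero.2 (Finset.mem_erase.1 h2).1)
        (h3.symm.trans h4)
      refine Prod.ext h5 ?_
      have h6 := (hL l hl).symm.trans (hL l' hl')
      simp only [lineAt, h5] at h6
      linarith
    · obtain ⟨⟨h2, h3⟩, h4⟩ := hslope l hl p hp
      obtain ⟨⟨h5, h6⟩, h7⟩ := hslope l hl p' hp'
      simp only [Finset.mem_filter, Finset.mem_product]
      refine ⟨⟨⟨h2, h5⟩, h3, h6⟩, ?_⟩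
      rw [h4, h7, mul_div_mul_left _ _ (h0 l hl)]
  exact (Nat.pow_le_pow_left h1 2).trans ((card_filter_eq_sq_le _ _
    (fun s : ℝ × ℝ => (s.1 - u) / (s.2 - u)) fun s : ℝ × ℝ => (s.1 - v) / (s.2 - v)).trans
    (Nat.mul_le_mul (card_div_eq_div_le_mulEbar A u) (card_div_eq_div_le_mulEbar B v)))

/-- The affine map `q.2⁻¹ ∘ q.1`. -/
noncomputable def affQuot (q : (ℝ × ℝ) × (ℝ × ℝ)) : ℝ × ℝ :=
  (q.1.1 / q.2.1, (q.1.2 - q.2.2) / q.2.1)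

lemma sq_card_le_card_mul_collisions {α β : Type*} [DecidableEq β] (I : Finset α) (B : Finset β)
    (f : α → β) (hf : ∀ i ∈ I, f i ∈ B) :
    I.card ^ 2 ≤ B.card * ((I ×ˢ I).filter fun q => f q.1 = f q.2).card := by
  rw [card_filter_eq_eq_sum I I f f hf, Finset.card_eq_sum_card_fiberwise hf]
  simp only [← sq]
  exact sq_sum_le_card_mul_sum_sq

lemma incidences_sq_le (A B : Finset ℝ) {L : Finset (ℝ × ℝ)} (h0 : ∀ l ∈ L, l.1 ≠ 0) :
    (∑ l ∈ L, (ptsOn (A ×ˢ B) l).card) ^ 2 ≤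
      B.card * ∑ q ∈ L ×ˢ L, (ptsOn (A ×ˢ A) (affQuot q)).card := by
  have h1 := sq_card_le_card_mul_collisions (L.sigma fun l => ptsOn (A ×ˢ B) l) B
    (fun i => i.2.2) fun i hi =>
      (Finset.mem_product.1 (mem_ptsOn.1 (Finset.mem_sigma.1 hi).2).1).2
  rw [Finset.card_sigma] at h1
  refine h1.trans (Nat.mul_le_mul_left _ ?_)
  rw [← Finset.card_sigma]
  refine Finset.card_le_card_of_injOn
    (fun q => ⟨(q.1.1, q.2.1), (q.1.2.1, q.2.2.1)⟩) (fun q hq => ?_) ?_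
  · obtain ⟨h2, h3⟩ := Finset.mem_filter.1 hq
    obtain ⟨h4, h5⟩ := Finset.mem_product.1 h2
    obtain ⟨h6, h7⟩ := Finset.mem_sigma.1 h4
    obtain ⟨h8, h9⟩ := Finset.mem_sigma.1 h5
    obtain ⟨ha, hb⟩ := mem_ptsOn.1 h7
    obtain ⟨hc, hd⟩ := mem_ptsOn.1 h9
    refine Finset.mem_sigma.2 ⟨Finset.mem_product.2 ⟨h6, h8⟩, mem_ptsOn.2
      ⟨Finset.mem_product.2 ⟨(Finset.mem_product.1 ha).1, (Finset.mem_product.1 hc).1⟩, ?_⟩⟩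
    have := h0 _ h8
    rw [hb, hd] at h3
    simp only [lineAt, affQuot] at h3 ⊢
    field_simp
    linarith
  · rintro ⟨⟨l, p⟩, l', p'⟩ hq ⟨⟨k, r⟩, k', r'⟩ hq' h
    simp only [Sigma.mk.injEq, Prod.mk.injEq, heq_eq_eq] at h
    obtain ⟨⟨rfl, rfl⟩, h1, h2⟩ := h
    simp only [Finset.coe_filter, Finset.mem_product, Finset.mem_sigma, Set.mem_ofPred_eq,
      mem_ptsOn] at hq hq'
    have e1 : p = r := Prod.ext h1 (by rw [hq.1.1.2.2, hq'.1.1.2.2, h1])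
    have e2 : p' = r' := Prod.ext h2 (by rw [hq.1.2.2.2, hq'.1.2.2.2, h2])
    rw [e1, e2]

lemma card_affQuot_eq_le {L : Finset (ℝ × ℝ)} (h0 : ∀ l ∈ L, l.1 ≠ 0) :
    (((L ×ˢ L) ×ˢ (L ×ˢ L)).filter fun q => affQuot q.1 = affQuot q.2).card ≤
      (affQuads L).card := by
  refine Finset.card_le_card_of_injOn (fun q => ((q.2.2, q.1.1), (q.1.2, q.2.1)))
    (fun q hq => ?_) ?_
  · obtain ⟨h1, h2⟩ := Finset.mem_filter.1 hq
    simp only [Finset.mem_product] at h1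
    refine mem_affQuads.2 ⟨⟨Finset.mem_product.2 ⟨h1.2.2, h1.1.1⟩,
      Finset.mem_product.2 ⟨h1.1.2, h1.2.1⟩⟩, ?_⟩
    have h3 := h0 _ h1.1.2
    have h4 := h0 _ h1.2.2
    simp only [affQuot, Prod.mk.injEq] at h2
    rw [div_eq_div_iff h3 h4, div_eq_div_iff h3 h4] at h2
    constructor
    · linarith [h2.1]
    · linarith [h2.2]
  · rintro ⟨⟨a, b⟩, c, d⟩ - ⟨⟨a', b'⟩, c', d'⟩ - h
    simp only [Prod.mk.injEq] at h ⊢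
    tauto

lemma sum_mul_cube_le {ι : Type*} (s : Finset ι) {r i : ι → ℝ} (hr : ∀ x ∈ s, 0 ≤ r x)
    (hi : ∀ x ∈ s, 0 ≤ i x) :
    (∑ x ∈ s, r x * i x) ^ 3 ≤ (∑ x ∈ s, r x) * (∑ x ∈ s, r x ^ 2) * ∑ x ∈ s, i x ^ 3 := by
  have h1 := Real.inner_le_Lp_mul_Lq_of_nonneg s (p := 3 / 2) (q := 3)
    (Real.holderConjugate_iff.2 ⟨by norm_num, by norm_num⟩) hr hi
  have h2 : ∑ x ∈ s, i x ^ (3 : ℝ) = ∑ x ∈ s, i x ^ 3 :=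
    Finset.sum_congr rfl fun x _ => by exact_mod_cast Real.rpow_natCast (i x) 3
  rw [h2] at h1
  have h3 : (∑ x ∈ s, r x ^ (3 / 2 : ℝ)) ^ 2 ≤ (∑ x ∈ s, r x) * (∑ x ∈ s, r x ^ 2) := by
    have h4 : ∑ x ∈ s, r x ^ (3 / 2 : ℝ) = ∑ x ∈ s, √(r x) * r x := by
      refine Finset.sum_congr rfl fun x hx => ?_
      rw [Real.sqrt_eq_rpow, ← Real.rpow_add_one' (hr x hx) (by norm_num)]
      norm_num
    rw [h4]
    refine (Finset.sum_mul_sq_le_sq_mul_sq _ _ _).trans (le_of_eq ?_)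
    congr 1
    exact Finset.sum_congr rfl fun x hx => Real.sq_sqrt (hr x hx)
  have hS0 : 0 ≤ ∑ x ∈ s, r x ^ (3 / 2 : ℝ) :=
    Finset.sum_nonneg fun x hx => Real.rpow_nonneg (hr x hx) _
  have hi0 : 0 ≤ ∑ x ∈ s, i x ^ 3 := Finset.sum_nonneg fun x hx => pow_nonneg (hi x hx) _
  have h5 : 0 ≤ ∑ x ∈ s, r x * i x := Finset.sum_nonneg fun x hx => mul_nonneg (hr x hx) (hi x hx)
  refine (pow_le_pow_left₀ h5 h1 3).trans ?_
  refine le_trans (le_of_eq ?_) (mul_le_mul_of_nonneg_right h3 hi0)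
  rw [mul_pow, ← Real.rpow_natCast, ← Real.rpow_natCast, ← Real.rpow_mul hS0, ← Real.rpow_mul hi0,
    ← Real.rpow_natCast]
  norm_num

lemma sum_mul_comp_cube_le {α β : Type*} [DecidableEq β] (S : Finset α) (f : α → β) {i : β → ℝ}
    (hi : ∀ x, 0 ≤ i x) :
    (∑ q ∈ S, i (f q)) ^ 3 ≤ S.card * ((S ×ˢ S).filter fun q => f q.1 = f q.2).card *
      ∑ x ∈ S.image f, i x ^ 3 := by
  have hf : ∀ q ∈ S, f q ∈ S.image f := fun q hq => Finset.mem_image_of_mem f hq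
  have h1 : ∑ q ∈ S, i (f q) =
      ∑ x ∈ S.image f, ((S.filter fun q => f q = x).card : ℝ) * i x := by
    rw [← Finset.sum_fiberwise_of_maps_to hf]
    refine Finset.sum_congr rfl fun x _ => ?_
    rw [Finset.sum_congr rfl (g := fun _ => i x) fun q hq => by rw [(Finset.mem_filter.1 hq).2],
      Finset.sum_const, nsmul_eq_mul]
  rw [h1]
  refine (sum_mul_cube_le _ (fun _ _ => Nat.cast_nonneg _) fun x _ => hi x).trans (le_of_eq ?_)
  rw [card_filter_eq_eq_sum S S f f hf, ← Nat.cast_sum, ← Finset.card_eq_sum_card_fiberwise hf]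
  simp only [← sq]
  push_cast
  rfl

lemma cube_le_sum_sq {i : ℕ} (hi : 2 ≤ i) : i ^ 3 ≤ 8 * ∑ v ∈ Finset.Icc 1 (i - 1), v ^ 2 := by
  obtain ⟨n, rfl⟩ : ∃ n, i = n + 1 := ⟨i - 1, by omega⟩
  rw [Nat.add_sub_cancel]
  induction n with
  | zero => omega
  | succ n ih =>
    rw [Finset.sum_Icc_succ_top (by omega)]
    rcases Nat.eq_zero_or_pos n with rfl | hn
    · norm_num
    · have := ih (by omega)
      nlinarith

lemma card_ptsOn_product_le (A B : Finset ℝ) (l : ℝ × ℝ) : (ptsOn (A ×ˢ B) l).card ≤ A.card := by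
  refine Finset.card_le_card_of_injOn Prod.fst
    (fun p hp => (Finset.mem_product.1 (mem_ptsOn.1 hp).1).1) fun p hp q hq h => ?_
  exact Prod.ext h (by rw [(mem_ptsOn.1 hp).2, (mem_ptsOn.1 hq).2, h])

lemma one_le_two_mul_log {n : ℕ} (hn : 2 ≤ n) : 1 ≤ 2 * Real.log n := by
  have h1 := Real.log_two_gt_d9
  have h2 : Real.log 2 ≤ Real.log n := Real.log_le_log (by norm_num) (by exact_mod_cast hn)
  linarith

/-- The third moment of the richness of lines in a Cartesian square. -/
lemma sum_card_ptsOn_cube_le {A : Finset ℝ} (hA : 2 ≤ A.card) (Λ : Finset (ℝ × ℝ))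
    (hΛ : ∀ l ∈ Λ, 2 ≤ (ptsOn (A ×ˢ A) l).card) :
    ∑ l ∈ Λ, ((ptsOn (A ×ˢ A) l).card : ℝ) ^ 3 ≤ 2 ^ 12 * (A.card : ℝ) ^ 4 * Real.log A.card := by
  have h1 : ∑ l ∈ Λ, (ptsOn (A ×ˢ A) l).card ^ 3 ≤ ∑ v ∈ Finset.Icc 1 A.card,
      8 * (v ^ 2 * (Λ.filter fun l => v + 1 ≤ (ptsOn (A ×ˢ A) l).card).card) := by
    simp only [Finset.card_filter, Finset.mul_sum]
    rw [Finset.sum_comm]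
    refine Finset.sum_le_sum fun l hl => (cube_le_sum_sq (hΛ l hl)).trans ?_
    rw [Finset.mul_sum]
    have : ∀ v ∈ Finset.Icc 1 A.card,
        8 * (v ^ 2 * (if v + 1 ≤ (ptsOn (A ×ˢ A) l).card then 1 else 0)) =
        if v + 1 ≤ (ptsOn (A ×ˢ A) l).card then 8 * v ^ 2 else 0 := by
      intro v _
      split_ifs <;> simp
    rw [Finset.sum_congr rfl this, ← Finset.sum_filter]
    refine Finset.sum_le_sum_of_subset fun v hv => ?_
    have := card_ptsOn_product_le A A l
    simp only [Finset.mem_filter, Finset.mem_Icc] at hv ⊢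
    omega
  set a : ℝ := (A.card : ℝ) with ha
  have h2 : ∀ v ∈ Finset.Icc 1 A.card,
      8 * ((v : ℝ) ^ 2 * ((Λ.filter fun l => v + 1 ≤ (ptsOn (A ×ˢ A) l).card).card : ℝ)) ≤
        64 * a ^ 3 + 1024 * a ^ 4 * (v : ℝ)⁻¹ := by
    intro v hv
    obtain ⟨hv1, hv2⟩ := Finset.mem_Icc.1 hv
    have hv0 : (0 : ℝ) < v := by exact_mod_cast hv1
    have hva : (v : ℝ) ≤ a := by rw [ha]; exact_mod_cast hv2
    have h3 := card_rich_le (A ×ˢ A) (Λ.filter fun l => v + 1 ≤ (ptsOn (A ×ˢ A) l).card) hv1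
      fun l hl => (Finset.mem_filter.1 hl).2
    rw [Finset.card_product, Nat.cast_mul, ← ha] at h3
    refine (mul_le_mul_of_nonneg_left (mul_le_mul_of_nonneg_left h3 (sq_nonneg (v : ℝ)))
      (by norm_num : (0 : ℝ) ≤ 8)).trans ?_
    have e : 8 * ((v : ℝ) ^ 2 * (8 * (a * a) / v + 128 * (a * a) ^ 2 / v ^ 3)) =
        64 * a ^ 2 * v + 1024 * a ^ 4 * (v : ℝ)⁻¹ := by
      field_simp
      ring
    rw [e]
    have := mul_le_mul_of_nonneg_left hva (by positivity : 0 ≤ 64 * a ^ 2)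
    linarith
  have h3 : ∑ l ∈ Λ, ((ptsOn (A ×ˢ A) l).card : ℝ) ^ 3 ≤ ∑ v ∈ Finset.Icc 1 A.card,
      8 * ((v : ℝ) ^ 2 * ((Λ.filter fun l => v + 1 ≤ (ptsOn (A ×ˢ A) l).card).card : ℝ)) := by
    exact_mod_cast h1
  have h4 := h3.trans (Finset.sum_le_sum h2)
  rw [Finset.sum_add_distrib, ← Finset.mul_sum (f := fun v : ℕ => (v : ℝ)⁻¹), Finset.sum_const,
    nsmul_eq_mul, Nat.card_Icc, Nat.add_sub_cancel, ← ha] at h4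
  have h5 : ∑ v ∈ Finset.Icc 1 A.card, (v : ℝ)⁻¹ ≤ 1 + Real.log a := by
    have := harmonic_le_one_add_log A.card
    rw [harmonic_eq_sum_Icc] at this
    push_cast at this
    exact this
  have h6 := one_le_two_mul_log hA
  rw [← ha] at h6
  have ha0 : 0 ≤ a := Nat.cast_nonneg _
  have h7 := mul_le_mul_of_nonneg_left h5 (by positivity : 0 ≤ 1024 * a ^ 4)
  have h8 := mul_le_mul_of_nonneg_left h6 (by positivity : 0 ≤ a ^ 4)
  have h9 : a * (64 * a ^ 3) = 64 * a ^ 4 := by ring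
  have h10 : 0 ≤ a ^ 4 * Real.log a := by nlinarith [pow_nonneg ha0 4]
  nlinarith

lemma card_rich_pow_le {A B : Finset ℝ} (hA : 2 ≤ A.card) {L : Finset (ℝ × ℝ)}
    (h0 : ∀ l ∈ L, l.1 ≠ 0) {w : ℕ} (hw : ∀ l ∈ L, w ≤ (ptsOn (A ×ˢ B) l).card)
    (hwB : 2 * B.card ≤ w ^ 2) :
    (w : ℝ) ^ 6 * (L.card : ℝ) ^ 4 ≤
      2 ^ 15 * (B.card : ℝ) ^ 3 * (A.card : ℝ) ^ 4 * Real.log A.card * (affQuads L).card := by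
  rcases L.eq_empty_or_nonempty with rfl | hne
  · simp [affQuads]
  have hN : (0 : ℝ) < L.card := by exact_mod_cast hne.card_pos
  set S := (L ×ˢ L).filter fun q => 2 ≤ (ptsOn (A ×ˢ A) (affQuot q)).card with hS
  have h1 : ((w : ℝ) * L.card) ^ 2 ≤
      B.card * ∑ q ∈ L ×ˢ L, ((ptsOn (A ×ˢ A) (affQuot q)).card : ℝ) := by
    have h2 : L.card * w ≤ ∑ l ∈ L, (ptsOn (A ×ˢ B) l).card := by
      rw [← smul_eq_mul]
      exact Finset.card_nsmul_le_sum _ _ _ hw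
    have := (Nat.pow_le_pow_left h2 2).trans (incidences_sq_le A B h0)
    rw [mul_comm (w : ℝ)]
    exact_mod_cast this
  have h2 : ∑ q ∈ L ×ˢ L, ((ptsOn (A ×ˢ A) (affQuot q)).card : ℝ) ≤
      ∑ q ∈ S, ((ptsOn (A ×ˢ A) (affQuot q)).card : ℝ) + (L.card : ℝ) ^ 2 := by
    rw [← Finset.sum_filter_add_sum_filter_not (L ×ˢ L)
      fun q => 2 ≤ (ptsOn (A ×ˢ A) (affQuot q)).card]
    refine add_le_add_right ?_ _
    have h3 : ∀ q ∈ (L ×ˢ L).filter fun q => ¬ 2 ≤ (ptsOn (A ×ˢ A) (affQuot q)).card,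
        ((ptsOn (A ×ˢ A) (affQuot q)).card : ℝ) ≤ 1 := by
      intro q hq
      have := (Finset.mem_filter.1 hq).2
      exact_mod_cast (by omega : (ptsOn (A ×ˢ A) (affQuot q)).card ≤ 1)
    refine (Finset.sum_le_card_nsmul _ _ _ h3).trans ?_
    rw [nsmul_eq_mul, mul_one, sq]
    exact_mod_cast (Finset.card_filter_le _ _).trans (Finset.card_product L L).le
  have h3 := sum_mul_comp_cube_le S affQuot
    (i := fun l => ((ptsOn (A ×ˢ A) l).card : ℝ)) fun _ => Nat.cast_nonneg _
  have h4 : ∑ x ∈ S.image affQuot, ((ptsOn (A ×ˢ A) x).card : ℝ) ^ 3 ≤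
      2 ^ 12 * (A.card : ℝ) ^ 4 * Real.log A.card := by
    refine sum_card_ptsOn_cube_le hA _ fun l hl => ?_
    obtain ⟨q, hq, rfl⟩ := Finset.mem_image.1 hl
    exact (Finset.mem_filter.1 hq).2
  have h5 : (S.card : ℝ) ≤ (L.card : ℝ) ^ 2 := by
    rw [sq]
    exact_mod_cast (Finset.card_filter_le _ _).trans (Finset.card_product L L).le
  have h6 : (((S ×ˢ S).filter fun q => affQuot q.1 = affQuot q.2).card : ℝ) ≤
      (affQuads L).card := by
    exact_mod_cast (Finset.card_le_card (Finset.filter_subset_filter _ (Finset.product_subset_product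
      (Finset.filter_subset _ _) (Finset.filter_subset _ _)))).trans (card_affQuot_eq_le h0)
  have hB : 2 * (B.card : ℝ) ≤ (w : ℝ) ^ 2 := by exact_mod_cast hwB
  have hlog : 0 ≤ Real.log A.card := by linarith [one_le_two_mul_log hA]
  have h7 : (∑ q ∈ S, ((ptsOn (A ×ˢ A) (affQuot q)).card : ℝ)) ^ 3 ≤
      (L.card : ℝ) ^ 2 * (affQuads L).card * (2 ^ 12 * (A.card : ℝ) ^ 4 * Real.log A.card) :=
    h3.trans (mul_le_mul (mul_le_mul h5 h6 (Nat.cast_nonneg _) (sq_nonneg _)) h4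
      (Finset.sum_nonneg fun _ _ => pow_nonneg (Nat.cast_nonneg _) _)
      (mul_nonneg (sq_nonneg _) (Nat.cast_nonneg _)))
  have hb0 : (0 : ℝ) ≤ B.card := Nat.cast_nonneg _
  generalize ∑ q ∈ S, ((ptsOn (A ×ˢ A) (affQuot q)).card : ℝ) = V at *
  generalize ∑ q ∈ L ×ˢ L, ((ptsOn (A ×ˢ A) (affQuot q)).card : ℝ) = U at *
  generalize ((affQuads L).card : ℝ) = E at *
  generalize (L.card : ℝ) = N at *
  generalize (B.card : ℝ) = b at *
  generalize (w : ℝ) = ω at *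
  generalize (A.card : ℝ) = a at *
  have h8 : (ω * N) ^ 2 ≤ 2 * b * V := by
    have := mul_le_mul_of_nonneg_left h2 hb0
    have := mul_le_mul_of_nonneg_right hB (sq_nonneg N)
    nlinarith
  have h9 := pow_le_pow_left₀ (sq_nonneg _) h8 3
  have h10 := mul_le_mul_of_nonneg_left h7 (by positivity : 0 ≤ 8 * b ^ 3)
  refine le_of_mul_le_mul_right (a := N ^ 2) ?_ (by positivity)
  calc ω ^ 6 * N ^ 4 * N ^ 2 = ((ω * N) ^ 2) ^ 3 := by ring
    _ ≤ (2 * b * V) ^ 3 := h9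
    _ = 8 * b ^ 3 * V ^ 3 := by ring
    _ ≤ _ := h10
    _ = _ := by ring

lemma exists_forall_le_of_bounded {ι : Type*} [Nonempty ι] (f : ι → ℕ) {n : ℕ}
    (hf : ∀ i, f i ≤ n) : ∃ i, ∀ j, f j ≤ f i := by
  have hb : BddAbove (Set.range f) := ⟨n, by rintro _ ⟨i, rfl⟩; exact hf i⟩
  obtain ⟨i, hi⟩ := Nat.sSup_mem (Set.range_nonempty f) hb
  exact ⟨i, fun j => hi ▸ le_csSup hb ⟨j, rfl⟩⟩

/-- The number of lines that are very rich in a Cartesian product. -/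
theorem card_rich_energy_bound {A B : Finset ℝ} (hA : 2 ≤ A.card) {L : Finset (ℝ × ℝ)}
    (h0 : ∀ l ∈ L, l.1 ≠ 0) {w : ℕ} (hw2 : 2 ≤ w) (hw : ∀ l ∈ L, w ≤ (ptsOn (A ×ˢ B) l).card)
    (hwB : 2 * B.card ≤ w ^ 2) :
    (w : ℝ) ^ 28 * (L.card : ℝ) ^ 6 ≤ 2 ^ 172 * (B.card : ℝ) ^ 12 * (A.card : ℝ) ^ 16 *
        Real.log A.card ^ 4 * (addE ℝ A A * addE ℝ B B) ∨
      (w : ℝ) ^ 16 * (L.card : ℝ) ^ 4 ≤ 2 ^ 90 * (B.card : ℝ) ^ 6 * (A.card : ℝ) ^ 8 *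
        Real.log A.card ^ 2 * (mulEbar ℝ A * mulEbar ℝ B) := by
  have hlog : 0 ≤ Real.log A.card := by linarith [one_le_two_mul_log hA]
  rcases L.eq_empty_or_nonempty with rfl | hne
  · left
    simp only [Finset.card_empty, Nat.cast_zero]
    rw [zero_pow (by norm_num), mul_zero]
    positivity
  have hN : (0 : ℝ) < L.card := by exact_mod_cast hne.card_pos
  obtain ⟨c, hc⟩ := exists_forall_le_of_bounded (fun c : ℝ => (L.filter fun p => p.1 = c).card)
    fun c => Finset.card_filter_le _ _
  obtain ⟨k, hk⟩ := exists_forall_le_of_bounded (fun k : ℝ × ℝ => (ptsOn L k).card)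
    fun c => Finset.card_filter_le _ _
  obtain ⟨l, hl⟩ := hne
  have hm1 : 1 ≤ (L.filter fun p => p.1 = c).card :=
    (Finset.card_pos.2 ⟨l, Finset.mem_filter.2 ⟨hl, rfl⟩⟩ :
      0 < (L.filter fun p => p.1 = l.1).card).trans_le (hc l.1)
  have hc0 : c ≠ 0 := by
    rintro rfl
    obtain ⟨l', hl'⟩ := Finset.card_pos.1 hm1
    exact h0 _ (Finset.mem_filter.1 hl').1 (Finset.mem_filter.1 hl').2
  have hpar := card_parallel_le A B hc0 (L := L.filter fun p => p.1 = c)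
    (fun l hl => (Finset.mem_filter.1 hl).2) fun l hl => hw l (Finset.mem_filter.1 hl).1
  have hcon := card_concurrent_le A B (w := w - 1) (u := -k.1) (v := k.2) (L := ptsOn L k)
    (fun l hl => h0 l (mem_ptsOn.1 hl).1) (fun l hl => by
      rw [lineAt, (mem_ptsOn.1 hl).2, lineAt]; ring)
    fun l hl => by
      have := hw l (mem_ptsOn.1 hl).1
      omega
  have hdich := card_affQuads_dichotomy h0 hm1 (Finset.card_filter_le _ _) hc hk
  have hmain := card_rich_pow_le hA h0 hw hwB
  have hpar' : ((L.filter fun p => p.1 = c).card * (w : ℝ) ^ 2) ^ 2 ≤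
      addE ℝ A A * addE ℝ B B := by exact_mod_cast hpar
  have hcon' : ((ptsOn L k).card * (w : ℝ) ^ 2) ^ 2 ≤ 16 * (mulEbar ℝ A * mulEbar ℝ B) := by
    have h1 : ((ptsOn L k).card * w ^ 2) ^ 2 ≤ 16 * ((ptsOn L k).card * (w - 1) ^ 2) ^ 2 := by
      have h2 : w ^ 2 ≤ 4 * (w - 1) ^ 2 := by
        have : w ≤ 2 * (w - 1) := by omega
        nlinarith
      have := Nat.pow_le_pow_left (Nat.mul_le_mul_left (ptsOn L k).card h2) 2
      linarith
    exact_mod_cast h1.trans (Nat.mul_le_mul_left 16 hcon)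
  have hb0 : (0 : ℝ) ≤ B.card := Nat.cast_nonneg _
  have ha0 : (0 : ℝ) ≤ A.card := Nat.cast_nonneg _
  have hw0 : (0 : ℝ) ≤ w := Nat.cast_nonneg _
  have hE0 : (0 : ℝ) ≤ (affQuads L).card := Nat.cast_nonneg _
  have hM0 : (0 : ℝ) ≤ (ptsOn L k).card := Nat.cast_nonneg _
  have hm0 : (0 : ℝ) ≤ (L.filter fun p => p.1 = c).card := Nat.cast_nonneg _
  generalize ((L.filter fun p => p.1 = c).card : ℝ) = m at *
  generalize ((ptsOn L k).card : ℝ) = M at *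
  generalize ((affQuads L).card : ℝ) = E at *
  generalize Real.log A.card = ℓ at *
  generalize (addE ℝ A A * addE ℝ B B : ℝ) = P at *
  generalize (mulEbar ℝ A * mulEbar ℝ B : ℝ) = Q at *
  generalize (L.card : ℝ) = N at *
  generalize (B.card : ℝ) = b at *
  generalize (w : ℝ) = ω at *
  generalize (A.card : ℝ) = a at *
  rcases hdich with h | h
  · left
    refine le_of_mul_le_mul_right (a := N ^ 10) ?_ (by positivity)
    have h1 : (ω ^ 6 * N ^ 4) ^ 2 ≤ (2 ^ 15 * b ^ 3 * a ^ 4 * ℓ) ^ 2 * (2 ^ 56 * N ^ 5 * m) := by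
      refine (pow_le_pow_left₀ (by positivity) hmain 2).trans ?_
      rw [mul_pow _ E]
      gcongr
    calc ω ^ 28 * N ^ 6 * N ^ 10 = ω ^ 4 * ((ω ^ 6 * N ^ 4) ^ 2) ^ 2 := by ring
      _ ≤ ω ^ 4 * ((2 ^ 15 * b ^ 3 * a ^ 4 * ℓ) ^ 2 * (2 ^ 56 * N ^ 5 * m)) ^ 2 := by gcongr
      _ = 2 ^ 172 * b ^ 12 * a ^ 16 * ℓ ^ 4 * N ^ 10 * (m * ω ^ 2) ^ 2 := by ring
      _ ≤ _ := by
        have := mul_le_mul_of_nonneg_left hpar'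
          (by positivity : 0 ≤ b ^ 12 * a ^ 16 * ℓ ^ 4 * N ^ 10)
        linarith
  · right
    refine le_of_mul_le_mul_right (a := N ^ 4) ?_ (by positivity)
    have h1 : ω ^ 6 * N ^ 4 ≤ 2 ^ 15 * b ^ 3 * a ^ 4 * ℓ * (2 ^ 28 * M * N ^ 2) := by
      refine hmain.trans ?_
      gcongr
    calc ω ^ 16 * N ^ 4 * N ^ 4 = ω ^ 4 * (ω ^ 6 * N ^ 4) ^ 2 := by ring
      _ ≤ ω ^ 4 * (2 ^ 15 * b ^ 3 * a ^ 4 * ℓ * (2 ^ 28 * M * N ^ 2)) ^ 2 := by gcongr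
      _ = 2 ^ 86 * b ^ 6 * a ^ 8 * ℓ ^ 2 * N ^ 4 * (M * ω ^ 2) ^ 2 := by ring
      _ ≤ _ := by
        have := mul_le_mul_of_nonneg_left hcon' (by positivity : 0 ≤ b ^ 6 * a ^ 8 * ℓ ^ 2 * N ^ 4)
        linarith

/-- Lines spanned by `A × B` which are neither vertical nor horizontal. -/
noncomputable def obliqueLines (A B : Finset ℝ) : Finset (ℝ × ℝ) :=
  (spannedLines (A ×ˢ B)).filter fun l => l.1 ≠ 0

lemma fst_ne_zero_of_mem_obliqueLines {A B : Finset ℝ} {l : ℝ × ℝ} (hl : l ∈ obliqueLines A B) :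
    l.1 ≠ 0 := (Finset.mem_filter.1 hl).2

lemma two_le_card_of_mem_obliqueLines {A B : Finset ℝ} {l : ℝ × ℝ} (hl : l ∈ obliqueLines A B) :
    2 ≤ (ptsOn (A ×ˢ B) l).card :=
  two_le_card_of_mem_spannedLines (Finset.mem_filter.1 hl).1

lemma card_ptsOn_product_le_right (A B : Finset ℝ) {l : ℝ × ℝ} (hl : l.1 ≠ 0) :
    (ptsOn (A ×ˢ B) l).card ≤ B.card := by
  refine Finset.card_le_card_of_injOn Prod.snd
    (fun p hp => (Finset.mem_product.1 (mem_ptsOn.1 hp).1).2) fun p hp q hq h => ?_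
  rw [(mem_ptsOn.1 hp).2, (mem_ptsOn.1 hq).2] at h
  simp only [lineAt] at h
  have h1 : p.1 = q.1 := mul_left_cancel₀ hl (by linarith)
  exact Prod.ext h1 (by rw [(mem_ptsOn.1 hp).2, (mem_ptsOn.1 hq).2, h1])

lemma collinear_range_cases {A B : Finset ℝ} {n : ℕ} {f : Fin (n + 1) → ℝ × ℝ}
    (hf : ∀ i, f i ∈ A ×ˢ B) (h : Collinear ℝ (Set.range f)) :
    (∀ i, (f i).1 = (f 0).1) ∨ (∀ i, (f i).2 = (f 0).2) ∨
      ∃ l ∈ obliqueLines A B, ∀ i, f i ∈ ptsOn (A ×ˢ B) l := by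
  obtain ⟨v, hv⟩ := (collinear_iff_of_mem (Set.mem_range_self 0)).1 h
  have hv' : ∀ i, ∃ r : ℝ, (f i).1 = r * v.1 + (f 0).1 ∧ (f i).2 = r * v.2 + (f 0).2 := by
    intro i
    obtain ⟨r, hr⟩ := hv _ (Set.mem_range_self i)
    exact ⟨r, by rw [hr]; simp, by rw [hr]; simp⟩
  by_contra hcon
  push Not at hcon
  obtain ⟨⟨i, hi⟩, ⟨j, hj⟩, hl⟩ := hcon
  obtain ⟨r, hr1, hr2⟩ := hv' i
  obtain ⟨s, hs1, hs2⟩ := hv' j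
  have hv1 : v.1 ≠ 0 := by
    intro h0
    rw [h0, mul_zero, zero_add] at hr1
    exact hi hr1
  have hv2 : v.2 ≠ 0 := by
    intro h0
    rw [h0, mul_zero, zero_add] at hs2
    exact hj hs2
  have hr0 : r ≠ 0 := by
    rintro rfl
    rw [zero_mul, zero_add] at hr1
    exact hi hr1
  have hslope : (lineThrough (f i) (f 0)).1 = v.2 / v.1 := by
    simp only [lineThrough]
    rw [hr1, hr2, add_sub_cancel_right, add_sub_cancel_right, mul_div_mul_left _ _ hr0]
  obtain ⟨k, hk⟩ := hl (lineThrough (f i) (f 0)) (Finset.mem_filter.2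
    ⟨Finset.mem_image.2 ⟨(f i, f 0), Finset.mem_filter.2
      ⟨Finset.mem_product.2 ⟨hf i, hf 0⟩, hi⟩, rfl⟩, by
        rw [hslope]; exact div_ne_zero hv2 hv1⟩)
  refine hk (mem_ptsOn.2 ⟨hf k, ?_⟩)
  have h2 := lineThrough_right hi
  obtain ⟨t, ht1, ht2⟩ := hv' k
  simp only [lineAt, hslope] at h2 ⊢
  rw [ht1, ht2, mul_add, mul_left_comm, div_mul_cancel₀ _ hv1]
  linarith

lemma collinear_of_lineAt {n : ℕ} {f : Fin (n + 1) → ℝ × ℝ} {l : ℝ × ℝ}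
    (h : ∀ i, (f i).2 = lineAt l (f i).1) : Collinear ℝ (Set.range f) := by
  refine (collinear_iff_of_mem (Set.mem_range_self 0)).2 ⟨(1, l.1), ?_⟩
  rintro _ ⟨i, rfl⟩
  refine ⟨(f i).1 - (f 0).1, Prod.ext ?_ ?_⟩
  · simp
  · have h1 := h i
    have h2 := h 0
    simp only [lineAt] at h1 h2
    simp only [vadd_eq_add, Prod.snd_add, Prod.smul_snd, smul_eq_mul]
    linarith

lemma collinear_of_fst_eq {n : ℕ} {f : Fin (n + 1) → ℝ × ℝ} {x : ℝ}
    (h : ∀ i, (f i).1 = x) : Collinear ℝ (Set.range f) := by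
  refine (collinear_iff_of_mem (Set.mem_range_self 0)).2 ⟨(0, 1), ?_⟩
  rintro _ ⟨i, rfl⟩
  refine ⟨(f i).2 - (f 0).2, Prod.ext ?_ ?_⟩
  · simp [h]
  · simp

lemma Ctuples_le (A B : Finset ℝ) (n : ℕ) :
    Ctuples ℝ (n + 1) A B ≤ A.card * B.card ^ (n + 1) + B.card * A.card ^ (n + 1) +
      ∑ l ∈ obliqueLines A B, (ptsOn (A ×ˢ B) l).card ^ (n + 1) := by
  have h1 : ((Fintype.piFinset fun _ : Fin (n + 1) => A ×ˢ B).filter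
      fun f => Collinear ℝ (Set.range f)) ⊆
      ((A.biUnion fun x => Fintype.piFinset fun _ : Fin (n + 1) => {x} ×ˢ B) ∪
        (B.biUnion fun y => Fintype.piFinset fun _ : Fin (n + 1) => A ×ˢ {y})) ∪
        (obliqueLines A B).biUnion fun l =>
          Fintype.piFinset fun _ : Fin (n + 1) => ptsOn (A ×ˢ B) l := by
    intro f hf
    obtain ⟨hf, hc⟩ := Finset.mem_filter.1 hf
    have hf' := fun i => Finset.mem_product.1 (Fintype.mem_piFinset.1 hf i)
    simp only [Finset.mem_union, Finset.mem_biUnion, Fintype.mem_piFinset, Finset.mem_product,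
      Finset.mem_singleton]
    rcases collinear_range_cases (Fintype.mem_piFinset.1 hf) hc with h | h | h
    · exact Or.inl (Or.inl ⟨_, (hf' 0).1, fun i => ⟨h i, (hf' i).2⟩⟩)
    · exact Or.inl (Or.inr ⟨_, (hf' 0).2, fun i => ⟨(hf' i).1, h i⟩⟩)
    · exact Or.inr h
  refine (Finset.card_le_card h1).trans ((Finset.card_union_le _ _).trans (Nat.add_le_add
    ((Finset.card_union_le _ _).trans (Nat.add_le_add ?_ ?_)) ?_))
  · refine Finset.card_biUnion_le_card_mul _ _ _ fun x _ => ?_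
    rw [Fintype.card_piFinset_const, Finset.card_product, Finset.card_singleton, one_mul]
  · refine Finset.card_biUnion_le_card_mul _ _ _ fun x _ => ?_
    rw [Fintype.card_piFinset_const, Finset.card_product, Finset.card_singleton, mul_one]
  · refine Finset.card_biUnion_le.trans (Finset.sum_le_sum fun l _ => ?_)
    rw [Fintype.card_piFinset_const]

lemma card_mul_pow_le_Ctuples (A B : Finset ℝ) (n : ℕ) :
    A.card * B.card ^ (n + 1) ≤ Ctuples ℝ (n + 1) A B := by
  have h : A.card * B.card ^ (n + 1) =
      (A ×ˢ Fintype.piFinset fun _ : Fin (n + 1) => B).card := by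
    rw [Finset.card_product, Fintype.card_piFinset_const]
  rw [h]
  refine Finset.card_le_card_of_injOn (fun q i => (q.1, q.2 i)) (fun q hq => ?_)
    fun q hq r hr h => ?_
  · obtain ⟨h1, h2⟩ := Finset.mem_product.1 hq
    rw [Fintype.mem_piFinset] at h2
    exact Finset.mem_filter.2 ⟨Fintype.mem_piFinset.2 fun i => Finset.mem_product.2 ⟨h1, h2 i⟩,
      collinear_of_fst_eq fun i => rfl⟩
  · have h1 := fun i => Prod.ext_iff.1 (congrFun h i)
    exact Prod.ext (h1 0).1 (funext fun i => (h1 i).2)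

lemma sum_cube_le_Ctuples (A B : Finset ℝ) :
    ∑ l ∈ obliqueLines A B, (ptsOn (A ×ˢ B) l).card ^ 3 ≤ 2 * Ctuples ℝ 3 A B := by
  have h1 : ∑ l ∈ obliqueLines A B, (ptsOn (A ×ˢ B) l).card ^ 3 ≤
      2 * ((obliqueLines A B).sigma
        fun l => (ptsOn (A ×ˢ B) l).offDiag ×ˢ ptsOn (A ×ˢ B) l).card := by
    rw [Finset.card_sigma, Finset.mul_sum]
    refine Finset.sum_le_sum fun l hl => ?_
    rw [Finset.card_product, Finset.offDiag_card]
    have h2 := two_le_card_of_mem_obliqueLines hl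
    generalize (ptsOn (A ×ˢ B) l).card = i at *
    obtain ⟨j, rfl⟩ : ∃ j, i = j + 2 := ⟨i - 2, by omega⟩
    have : (j + 2) * (j + 2) - (j + 2) = (j + 2) * (j + 1) := by
      rw [← Nat.mul_sub_one]
      rfl
    rw [this]
    nlinarith [Nat.zero_le j, Nat.zero_le (j ^ 2)]
  refine h1.trans (Nat.mul_le_mul_left 2 ?_)
  refine Finset.card_le_card_of_injOn (fun x => ![x.2.1.1, x.2.1.2, x.2.2]) (fun x hx => ?_) ?_
  · obtain ⟨hl, hp⟩ := Finset.mem_sigma.1 hx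
    obtain ⟨hp, hr⟩ := Finset.mem_product.1 hp
    obtain ⟨hp, hq, -⟩ := Finset.mem_offDiag.1 hp
    rw [mem_ptsOn] at hp hq hr
    refine Finset.mem_filter.2 ⟨Fintype.mem_piFinset.2 fun i => ?_,
      collinear_of_lineAt (l := x.1) fun i => ?_⟩
    · fin_cases i
      exacts [hp.1, hq.1, hr.1]
    · fin_cases i
      exacts [hp.2, hq.2, hr.2]
  · rintro ⟨l, ⟨p, q⟩, r⟩ hx ⟨l', ⟨p', q'⟩, r'⟩ hy h
    have e1 : p = p' := congrFun h 0
    have e2 : q = q' := congrFun h 1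
    have e3 : r = r' := congrFun h 2
    subst e1 e2 e3
    obtain ⟨-, hp⟩ := Finset.mem_sigma.1 hx
    obtain ⟨-, hp'⟩ := Finset.mem_sigma.1 hy
    obtain ⟨hp, hq, hne⟩ := Finset.mem_offDiag.1 (Finset.mem_product.1 hp).1
    obtain ⟨hp', hq', -⟩ := Finset.mem_offDiag.1 (Finset.mem_product.1 hp').1
    have hll : l = l' := lineAt_injOn (fst_ne_of_mem_ptsOn hp hq hne)
      ((mem_ptsOn.1 hp).2.symm.trans (mem_ptsOn.1 hp').2)
      ((mem_ptsOn.1 hq).2.symm.trans (mem_ptsOn.1 hq').2)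
    rw [hll]

lemma card_sq_le_addE (A : Finset ℝ) : A.card ^ 2 ≤ addE ℝ A A := by
  rw [sq, ← Finset.card_product]
  refine Finset.card_le_card_of_injOn (fun q => ((q.1, q.1), (q.2, q.2))) (fun q hq => ?_)
    fun q _ r _ h => ?_
  · obtain ⟨h1, h2⟩ := Finset.mem_product.1 hq
    exact Finset.mem_filter.2 ⟨Finset.mem_product.2 ⟨Finset.mem_product.2 ⟨h1, h1⟩,
      Finset.mem_product.2 ⟨h2, h2⟩⟩, rfl⟩
  · simp only [Prod.mk.injEq] at h
    exact Prod.ext h.1.1 h.2.1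

/-- Lines of `obliqueLines A B` with at least `w` points. -/
noncomputable def richLines (A B : Finset ℝ) (w : ℕ) : Finset (ℝ × ℝ) :=
  (obliqueLines A B).filter fun l => w ≤ (ptsOn (A ×ˢ B) l).card

lemma fourth_le_sum_cube {i : ℕ} (hi : 2 ≤ i) :
    i ^ 4 ≤ 4 * ∑ w ∈ Finset.Icc 2 i, w ^ 3 := by
  induction i, hi using Nat.le_induction with
  | base => simp
  | succ n hn ih =>
    rw [Finset.sum_Icc_succ_top (by omega)]
    nlinarith [Nat.zero_le (n ^ 2)]

lemma sum_fourth_le (A B : Finset ℝ) :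
    ∑ l ∈ obliqueLines A B, (ptsOn (A ×ˢ B) l).card ^ 4 ≤
      4 * ∑ w ∈ Finset.Icc 2 (min A.card B.card), w ^ 3 * (richLines A B w).card := by
  simp only [richLines, Finset.card_filter, Finset.mul_sum]
  rw [Finset.sum_comm]
  refine Finset.sum_le_sum fun l hl =>
    (fourth_le_sum_cube (two_le_card_of_mem_obliqueLines hl)).trans ?_
  rw [Finset.mul_sum]
  have : ∀ w ∈ Finset.Icc 2 (min A.card B.card),
      4 * (w ^ 3 * (if w ≤ (ptsOn (A ×ˢ B) l).card then 1 else 0)) =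
      if w ≤ (ptsOn (A ×ˢ B) l).card then 4 * w ^ 3 else 0 := by
    intro v _
    split_ifs <;> simp
  rw [Finset.sum_congr rfl this, ← Finset.sum_filter]
  refine Finset.sum_le_sum_of_subset fun w hw => ?_
  have h1 := card_ptsOn_product_le A B l
  have h2 := card_ptsOn_product_le_right A B (fst_ne_zero_of_mem_obliqueLines hl)
  simp only [Finset.mem_filter, Finset.mem_Icc, le_min_iff] at hw ⊢
  omega

lemma cube_mul_card_richLines_le (A B : Finset ℝ) (w : ℕ) :
    w ^ 3 * (richLines A B w).card ≤ 2 * Ctuples ℝ 3 A B := by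
  refine le_trans ?_ (sum_cube_le_Ctuples A B)
  refine le_trans ?_ (Finset.sum_le_sum_of_subset (Finset.filter_subset
    (fun l => w ≤ (ptsOn (A ×ˢ B) l).card) _))
  rw [mul_comm, ← smul_eq_mul]
  exact Finset.card_nsmul_le_sum _ _ _ fun l hl =>
    Nat.pow_le_pow_left (Finset.mem_filter.1 hl).2 3

lemma cube_mul_card_richLines_le_sq (A B : Finset ℝ) {w : ℕ} (hw : 2 ≤ w) (hA : w ≤ A.card)
    (hB : w ≤ B.card) :
    (w : ℝ) ^ 3 * (richLines A B w).card ≤ 2 ^ 11 * (A.card : ℝ) ^ 2 * (B.card : ℝ) ^ 2 := by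
  obtain ⟨v, rfl⟩ : ∃ v, w = v + 1 := ⟨w - 1, by omega⟩
  have h1 := card_rich_le (A ×ˢ B) (richLines A B (v + 1)) (w := v) (by omega)
    fun l hl => (Finset.mem_filter.1 hl).2
  rw [Finset.card_product] at h1
  push_cast at h1 ⊢
  have hv : (1 : ℝ) ≤ v := by exact_mod_cast (by omega : 1 ≤ v)
  have hva : (v : ℝ) ≤ A.card := by exact_mod_cast (by omega : v ≤ A.card)
  have hvb : (v : ℝ) ≤ B.card := by exact_mod_cast (by omega : v ≤ B.card)
  generalize (v : ℝ) = x at *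
  generalize (A.card : ℝ) = a at *
  generalize (B.card : ℝ) = b at *
  have hx0 : 0 < x := by linarith
  have h2 : (x + 1) ^ 3 ≤ 8 * x ^ 3 := by
    have := pow_le_pow_left₀ (by linarith) (by linarith : x + 1 ≤ 2 * x) 3
    linarith
  have h3 : x ^ 2 ≤ a * b := by rw [sq]; exact mul_le_mul hva hvb hx0.le (by linarith)
  calc (x + 1) ^ 3 * ((richLines A B (v + 1)).card : ℝ)
      ≤ 8 * x ^ 3 * (8 * (a * b) / x + 128 * (a * b) ^ 2 / x ^ 3) :=
        mul_le_mul h2 h1 (Nat.cast_nonneg _) (by positivity)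
    _ = 64 * (a * b) * x ^ 2 + 1024 * (a * b) ^ 2 := by
        field_simp
        ring
    _ ≤ 64 * (a * b) * (a * b) + 1024 * (a * b) ^ 2 := by
        have : 0 ≤ a * b := (sq_nonneg x).trans h3
        gcongr
    _ ≤ _ := by nlinarith [sq_nonneg (a * b)]

lemma sum_Ico_inv_mul_sqrt_le {m : ℕ} (hm : 1 ≤ m) (n : ℕ) (hn : m ≤ n) :
    ∑ w ∈ Finset.Ico m n, 1 / ((w : ℝ) * √w) ≤ 4 * (1 / √m - 1 / √n) := by
  induction n, hn using Nat.le_induction with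
  | base => simp
  | succ n hmn ih =>
    rw [Finset.sum_Ico_succ_top hmn]
    have hn1 : (1 : ℝ) ≤ n := by exact_mod_cast hm.trans hmn
    have key : 1 / ((n : ℝ) * √n) ≤ 4 * (1 / √n - 1 / √((n + 1 : ℕ) : ℝ)) := by
      push_cast
      have hs : √(n : ℝ) ^ 2 = n := Real.sq_sqrt (by linarith)
      have ht : √((n : ℝ) + 1) ^ 2 = n + 1 := Real.sq_sqrt (by linarith)
      have hs1 : 1 ≤ √(n : ℝ) := Real.one_le_sqrt.2 hn1
      have hst : √(n : ℝ) ≤ √((n : ℝ) + 1) := Real.sqrt_le_sqrt (by linarith)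
      set s := √(n : ℝ)
      set t := √((n : ℝ) + 1)
      rw [← hs] at ht ⊢
      have h2 : t ≤ 2 * s := by nlinarith
      have h3 : t * (t + s) ≤ 4 * s ^ 2 := by nlinarith
      have h4 : (t - s) * (t + s) = 1 := by nlinarith
      have h5 : t ≤ 4 * s ^ 2 * (t - s) := by
        have : t * (t + s) * (t - s) ≤ 4 * s ^ 2 * (t - s) :=
          mul_le_mul_of_nonneg_right h3 (by linarith)
        nlinarith
      have hs0 : 0 < s := by linarith
      have ht0 : 0 < t := by linarith
      rw [div_sub_div _ _ hs0.ne' ht0.ne', mul_div_assoc', div_le_div_iff₀ (by positivity)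
        (by positivity)]
      nlinarith [mul_le_mul_of_nonneg_left h5 hs0.le]
    linarith

lemma sum_inv_mul_sqrt_le {y : ℝ} (hy : 0 < y) (S : Finset ℕ) (hS : ∀ w ∈ S, y < w) :
    ∑ w ∈ S, 1 / ((w : ℝ) * √w) ≤ 4 / √y := by
  have hsub : S ⊆ Finset.Ico (⌊y⌋₊ + 1) (⌊y⌋₊ + 1 + S.sup id + 1) := by
    intro w hw
    have h1 : ⌊y⌋₊ < w := (Nat.floor_lt hy.le).2 (hS w hw)
    have h2 : w ≤ S.sup id := Finset.le_sup (f := id) hw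
    rw [Finset.mem_Ico]
    omega
  have h1 := Finset.sum_le_sum_of_subset_of_nonneg hsub
    (f := fun w : ℕ => 1 / ((w : ℝ) * √w)) fun _ _ _ => by positivity
  have h2 := sum_Ico_inv_mul_sqrt_le (m := ⌊y⌋₊ + 1) (by omega) (⌊y⌋₊ + 1 + S.sup id + 1) (by omega)
  have h3 : 1 / √((⌊y⌋₊ + 1 : ℕ) : ℝ) ≤ 1 / √y := by
    have := (Nat.lt_floor_add_one y).le
    apply one_div_le_one_div_of_le (Real.sqrt_pos.2 hy)
    apply Real.sqrt_le_sqrt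
    push_cast
    exact this
  have h4 : 0 ≤ 1 / √((⌊y⌋₊ + 1 + S.sup id + 1 : ℕ) : ℝ) := by positivity
  have h5 : 4 / √y = 4 * (1 / √y) := by ring
  rw [h5]
  linarith

lemma sum_le_of_pow_six_mul_pow_ten_le {S : Finset ℕ} {T : ℕ → ℝ} {D X : ℝ} (hD : 0 < D)
    (hX : 0 < X) (hT0 : ∀ w ∈ S, 0 ≤ T w) (hTD : ∀ w ∈ S, T w ≤ D) (hS : ∀ w ∈ S, 1 ≤ w)
    (hT : ∀ w ∈ S, T w ^ 6 * (w : ℝ) ^ 10 ≤ X ^ 6) :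
    ∑ w ∈ S, T w ≤ 5 * (D ^ (2 / 5 : ℝ) * X ^ (3 / 5 : ℝ)) := by
  obtain ⟨d, hd, rfl⟩ : ∃ d : ℝ, 0 < d ∧ d ^ 10 = D :=
    ⟨D ^ (1 / 10 : ℝ), by positivity, by
      rw [← Real.rpow_natCast, ← Real.rpow_mul hD.le]; norm_num⟩
  obtain ⟨x, hx, rfl⟩ : ∃ x : ℝ, 0 < x ∧ x ^ 10 = X :=
    ⟨X ^ (1 / 10 : ℝ), by positivity, by
      rw [← Real.rpow_natCast, ← Real.rpow_mul hX.le]; norm_num⟩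
  have e1 : (d ^ 10) ^ (2 / 5 : ℝ) = d ^ 4 := by
    rw [← Real.rpow_natCast, ← Real.rpow_mul hd.le, ← Real.rpow_natCast]; norm_num
  have e2 : (x ^ 10) ^ (3 / 5 : ℝ) = x ^ 6 := by
    rw [← Real.rpow_natCast, ← Real.rpow_mul hx.le, ← Real.rpow_natCast]; norm_num
  rw [e1, e2]
  set σ := x / d with hσ
  have hσ0 : 0 < σ := by positivity
  have hxd : x = σ * d := by rw [hσ]; field_simp
  rw [← Finset.sum_filter_add_sum_filter_not S (fun w : ℕ => (w : ℝ) ≤ σ ^ 6)]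
  have hlow : ∑ w ∈ S.filter (fun w : ℕ => (w : ℝ) ≤ σ ^ 6), T w ≤ d ^ 10 * σ ^ 6 := by
    have hc : ((S.filter fun w : ℕ => (w : ℝ) ≤ σ ^ 6).card : ℝ) ≤ σ ^ 6 := by
      have hsub : (S.filter fun w : ℕ => (w : ℝ) ≤ σ ^ 6) ⊆ Finset.Icc 1 ⌊σ ^ 6⌋₊ := by
        intro w hw
        rw [Finset.mem_filter] at hw
        exact Finset.mem_Icc.2 ⟨hS w hw.1, Nat.le_floor hw.2⟩
      have := Finset.card_le_card hsub
      rw [Nat.card_Icc, Nat.add_sub_cancel] at this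
      exact (Nat.cast_le.2 this).trans (Nat.floor_le (by positivity))
    have := Finset.sum_le_card_nsmul (S.filter fun w : ℕ => (w : ℝ) ≤ σ ^ 6) T (d ^ 10)
      fun w hw => hTD w (Finset.mem_filter.1 hw).1
    rw [nsmul_eq_mul] at this
    have h2 := mul_le_mul_of_nonneg_right hc hD.le
    linarith
  have hhigh : ∑ w ∈ S.filter (fun w : ℕ => ¬ (w : ℝ) ≤ σ ^ 6), T w ≤ x ^ 10 / σ * (4 / √(σ ^ 6)) := by
    have h1 := sum_inv_mul_sqrt_le (y := σ ^ 6) (by positivity)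
      (S.filter fun w : ℕ => ¬ (w : ℝ) ≤ σ ^ 6)
      fun w hw => not_le.1 (Finset.mem_filter.1 hw).2
    refine le_trans ?_ (mul_le_mul_of_nonneg_left h1 (by positivity : 0 ≤ x ^ 10 / σ))
    rw [Finset.mul_sum]
    refine Finset.sum_le_sum fun w hw => ?_
    rw [Finset.mem_filter, not_le] at hw
    have hw1 : (1 : ℝ) ≤ w := by exact_mod_cast hS w hw.1
    have hw0 : (0 : ℝ) < w := by linarith
    have hs : √(w : ℝ) ^ 2 = w := Real.sq_sqrt hw0.le
    have hsp : 0 < √(w : ℝ) := Real.sqrt_pos.2 hw0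
    have ht0 := hT0 w hw.1
    have hle : T w * (w * √(w : ℝ) * σ) ≤ x ^ 10 := by
      refine le_of_pow_le_pow_left₀ (n := 6) (by norm_num) hX.le ?_
      have e : (T w * (w * √(w : ℝ) * σ)) ^ 6 = T w ^ 6 * (w : ℝ) ^ 9 * σ ^ 6 := by
        calc _ = T w ^ 6 * (w : ℝ) ^ 6 * (√(w : ℝ) ^ 2) ^ 3 * σ ^ 6 := by ring
          _ = _ := by rw [hs]; ring
      rw [e]
      have h3 := mul_le_mul_of_nonneg_left hw.2.le
        (by positivity : 0 ≤ T w ^ 6 * (w : ℝ) ^ 9)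
      have h4 := hT w hw.1
      calc _ ≤ T w ^ 6 * (w : ℝ) ^ 9 * w := h3
        _ = T w ^ 6 * (w : ℝ) ^ 10 := by ring
        _ ≤ _ := h4
    rw [div_mul_div_comm, mul_one, le_div_iff₀ (by positivity)]
    calc _ = T w * (w * √(w : ℝ) * σ) := by ring
      _ ≤ _ := hle
  have hsq : √(σ ^ 6) = σ ^ 3 := by
    rw [show σ ^ 6 = (σ ^ 3) ^ 2 by ring, Real.sqrt_sq (by positivity)]
  rw [hsq] at hhigh
  have e3 : x ^ 10 / σ * (4 / σ ^ 3) = 4 * (d ^ 4 * x ^ 6) := by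
    rw [hxd]; field_simp
  have e4 : d ^ 10 * σ ^ 6 = d ^ 4 * x ^ 6 := by
    rw [hxd]; ring
  linarith

lemma sum_Icc_inv_le_one_add_log (n : ℕ) :
    ∑ w ∈ Finset.Icc 1 n, 1 / (w : ℝ) ≤ 1 + Real.log n := by
  have := harmonic_le_one_add_log n
  rw [harmonic_eq_sum_Icc] at this
  push_cast at this
  simpa only [one_div] using this

lemma sum_le_of_pow_four_mul_pow_four_le {S : Finset ℕ} {T : ℕ → ℝ} {Y : ℝ} {n : ℕ} (hn : 2 ≤ n)
    (hY : 0 ≤ Y) (hS : ∀ w ∈ S, 1 ≤ w ∧ w ≤ n)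
    (hT : ∀ w ∈ S, T w ^ 4 * (w : ℝ) ^ 4 ≤ Y ^ 4) :
    ∑ w ∈ S, T w ≤ 3 * (Y * Real.log n) := by
  have h1 : ∀ w ∈ S, T w ≤ Y * (1 / (w : ℝ)) := by
    intro w hw
    have hw0 : (0 : ℝ) < w := by exact_mod_cast (hS w hw).1
    have : T w * w ≤ Y := by
      refine le_of_pow_le_pow_left₀ (n := 4) (by norm_num) hY ?_
      rw [mul_pow]
      exact hT w hw
    rw [mul_one_div, le_div_iff₀ hw0]
    exact this
  have h2 : ∑ w ∈ S, 1 / (w : ℝ) ≤ 1 + Real.log n :=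
    (Finset.sum_le_sum_of_subset_of_nonneg (fun w hw => Finset.mem_Icc.2 (hS w hw))
      fun _ _ _ => by positivity).trans (sum_Icc_inv_le_one_add_log n)
  have h3 := one_le_two_mul_log hn
  have h4 := Finset.sum_le_sum h1
  rw [← Finset.mul_sum] at h4
  have h5 := mul_le_mul_of_nonneg_left (h2.trans (by linarith : _ ≤ 3 * Real.log n)) hY
  linarith

lemma sq_mul_sq_mul_sqrt_le {a b P C l : ℝ} (ha : 1 ≤ a) (hb : 1 ≤ b) (hP : a ^ 2 * b ^ 2 ≤ P)
    (hC : a * b ^ 3 ≤ C) (hl : 1 / 2 ≤ l) :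
    a ^ 2 * b ^ 2 * √b ≤ 2 * (P ^ (1 / 10 : ℝ) * C ^ (2 / 5 : ℝ) * a ^ (8 / 5 : ℝ) *
      b ^ (6 / 5 : ℝ) * l ^ (2 / 5 : ℝ)) := by
  have ha0 : 0 < a := by linarith
  have hb0 : 0 < b := by linarith
  have e1 : (a ^ 2 * b ^ 2) ^ (1 / 10 : ℝ) = a ^ (1 / 5 : ℝ) * b ^ (1 / 5 : ℝ) := by
    rw [Real.mul_rpow (by positivity) (by positivity), ← Real.rpow_natCast,
      ← Real.rpow_natCast, ← Real.rpow_mul ha0.le, ← Real.rpow_mul hb0.le]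
    norm_num
  have e2 : (a * b ^ 3) ^ (2 / 5 : ℝ) = a ^ (2 / 5 : ℝ) * b ^ (6 / 5 : ℝ) := by
    rw [Real.mul_rpow (by positivity) (by positivity), ← Real.rpow_natCast,
      ← Real.rpow_mul hb0.le]
    norm_num
  have e3 : (1 / 2 : ℝ) ≤ (1 / 2 : ℝ) ^ (2 / 5 : ℝ) := by
    conv_lhs => rw [← Real.rpow_one (1 / 2 : ℝ)]
    exact Real.rpow_le_rpow_of_exponent_ge (by norm_num) (by norm_num) (by norm_num)
  have hP' : a ^ (1 / 5 : ℝ) * b ^ (1 / 5 : ℝ) ≤ P ^ (1 / 10 : ℝ) := by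
    rw [← e1]; exact Real.rpow_le_rpow (by positivity) hP (by norm_num)
  have hC' : a ^ (2 / 5 : ℝ) * b ^ (6 / 5 : ℝ) ≤ C ^ (2 / 5 : ℝ) := by
    rw [← e2]; exact Real.rpow_le_rpow (by positivity) hC (by norm_num)
  have hl' : (1 / 2 : ℝ) ≤ l ^ (2 / 5 : ℝ) :=
    e3.trans (Real.rpow_le_rpow (by norm_num) hl (by norm_num))
  have e4 : a ^ (1 / 5 : ℝ) * b ^ (1 / 5 : ℝ) * (a ^ (2 / 5 : ℝ) * b ^ (6 / 5 : ℝ)) *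
      a ^ (8 / 5 : ℝ) * b ^ (6 / 5 : ℝ) = a ^ (11 / 5 : ℝ) * b ^ (13 / 5 : ℝ) := by
    calc _ = (a ^ (1 / 5 : ℝ) * a ^ (2 / 5 : ℝ) * a ^ (8 / 5 : ℝ)) *
          (b ^ (1 / 5 : ℝ) * b ^ (6 / 5 : ℝ) * b ^ (6 / 5 : ℝ)) := by ring
      _ = _ := by
        rw [← Real.rpow_add ha0, ← Real.rpow_add ha0, ← Real.rpow_add hb0, ← Real.rpow_add hb0]
        norm_num
  have e5 : a ^ 2 ≤ a ^ (11 / 5 : ℝ) := by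
    rw [← Real.rpow_natCast]
    exact Real.rpow_le_rpow_of_exponent_le ha (by norm_num)
  have e6 : b ^ 2 * √b ≤ b ^ (13 / 5 : ℝ) := by
    rw [← Real.rpow_natCast, Real.sqrt_eq_rpow, ← Real.rpow_add hb0]
    exact Real.rpow_le_rpow_of_exponent_le hb (by norm_num)
  have h1 : a ^ 2 * (b ^ 2 * √b) ≤ a ^ (11 / 5 : ℝ) * b ^ (13 / 5 : ℝ) :=
    mul_le_mul e5 e6 (by positivity) (by positivity)
  have h2 : a ^ (11 / 5 : ℝ) * b ^ (13 / 5 : ℝ) * (1 / 2) ≤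
      P ^ (1 / 10 : ℝ) * C ^ (2 / 5 : ℝ) * a ^ (8 / 5 : ℝ) * b ^ (6 / 5 : ℝ) *
        l ^ (2 / 5 : ℝ) := by
    have hP0 : 0 ≤ P := le_trans (by positivity) hP
    have hC0 : 0 ≤ C := le_trans (by positivity) hC
    rw [← e4]
    gcongr
  linarith

lemma exists_pow_six_eq {a b P C l : ℝ} (ha : 0 < a) (hb : 0 < b) (hP : 0 < P) (hC : 0 < C)
    (hl : 0 < l) : ∃ X : ℝ, 0 < X ∧ 2 ^ 172 * b ^ 12 * a ^ 16 * l ^ 4 * P ≤ X ^ 6 ∧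
      (2 * C) ^ (2 / 5 : ℝ) * X ^ (3 / 5 : ℝ) ≤ 2 ^ 19 * (P ^ (1 / 10 : ℝ) * C ^ (2 / 5 : ℝ) *
        a ^ (8 / 5 : ℝ) * b ^ (6 / 5 : ℝ) * l ^ (2 / 5 : ℝ)) := by
  have key : ∀ r : ℝ, 0 < r → ∀ n : ℕ, (r ^ n) ^ (1 / 10 : ℝ) = r ^ ((n : ℝ) / 10) := by
    intro r hr n
    rw [← Real.rpow_natCast, ← Real.rpow_mul hr.le, mul_one_div]
  refine ⟨2 ^ 30 * (b ^ 12 * a ^ 16 * l ^ 4 * P) ^ (1 / 6 : ℝ), by positivity, ?_, ?_⟩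
  · have h0 : 0 < b ^ 12 * a ^ 16 * l ^ 4 * P := by positivity
    have e : ((b ^ 12 * a ^ 16 * l ^ 4 * P) ^ (1 / 6 : ℝ)) ^ 6 = b ^ 12 * a ^ 16 * l ^ 4 * P := by
      rw [← Real.rpow_natCast, ← Real.rpow_mul h0.le]; norm_num
    rw [mul_pow, e]
    have : (2 : ℝ) ^ 172 ≤ (2 ^ 30) ^ 6 := by norm_num
    have := mul_le_mul_of_nonneg_right this h0.le
    linarith
  · have h0 : 0 < b ^ 12 * a ^ 16 * l ^ 4 * P := by positivity
    have e1 : ((2 : ℝ) ^ 30) ^ (3 / 5 : ℝ) = 2 ^ 18 := by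
      rw [← Real.rpow_natCast, ← Real.rpow_mul (by norm_num), ← Real.rpow_natCast]; norm_num
    have e2 : ((b ^ 12 * a ^ 16 * l ^ 4 * P) ^ (1 / 6 : ℝ)) ^ (3 / 5 : ℝ) =
        b ^ (6 / 5 : ℝ) * a ^ (8 / 5 : ℝ) * l ^ (2 / 5 : ℝ) * P ^ (1 / 10 : ℝ) := by
      rw [← Real.rpow_mul h0.le, show (1 / 6 : ℝ) * (3 / 5) = 1 / 10 by norm_num,
        Real.mul_rpow (by positivity) hP.le, Real.mul_rpow (by positivity) (by positivity),
        Real.mul_rpow (by positivity) (by positivity), key b hb, key a ha, key l hl]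
      norm_num
    have e3 : (2 : ℝ) ^ (2 / 5 : ℝ) ≤ 2 := by
      conv_rhs => rw [← Real.rpow_one (2 : ℝ)]
      exact Real.rpow_le_rpow_of_exponent_le (by norm_num) (by norm_num)
    rw [Real.mul_rpow (by norm_num) hC.le, Real.mul_rpow (by norm_num) (by positivity), e1, e2]
    set R := P ^ (1 / 10 : ℝ) * C ^ (2 / 5 : ℝ) * a ^ (8 / 5 : ℝ) * b ^ (6 / 5 : ℝ) *
      l ^ (2 / 5 : ℝ) with hR
    have hR0 : 0 ≤ R := by positivity
    calc _ = 2 ^ (2 / 5 : ℝ) * R * 2 ^ 18 := by rw [hR]; ring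
      _ ≤ 2 * R * 2 ^ 18 := by gcongr
      _ = _ := by ring

lemma exists_pow_four_eq {a b Q l : ℝ} (ha : 0 < a) (hb : 0 < b) (hQ : 0 ≤ Q) (hl : 0 < l) :
    ∃ Y : ℝ, 0 ≤ Y ∧ 2 ^ 90 * b ^ 6 * a ^ 8 * l ^ 2 * Q ≤ Y ^ 4 ∧
      Y * l = 2 ^ 23 * (Q ^ (1 / 4 : ℝ) * a ^ 2 * b ^ (3 / 2 : ℝ) * l ^ (3 / 2 : ℝ)) := by
  have key : ∀ r : ℝ, 0 < r → ∀ n : ℕ, (r ^ n) ^ (1 / 4 : ℝ) = r ^ ((n : ℝ) / 4) := by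
    intro r hr n
    rw [← Real.rpow_natCast, ← Real.rpow_mul hr.le, mul_one_div]
  have h0 : 0 ≤ b ^ 6 * a ^ 8 * l ^ 2 * Q := by positivity
  refine ⟨2 ^ 23 * (b ^ 6 * a ^ 8 * l ^ 2 * Q) ^ (1 / 4 : ℝ), by positivity, ?_, ?_⟩
  · have e : ((b ^ 6 * a ^ 8 * l ^ 2 * Q) ^ (1 / 4 : ℝ)) ^ 4 = b ^ 6 * a ^ 8 * l ^ 2 * Q := by
      rw [← Real.rpow_natCast, ← Real.rpow_mul h0]; norm_num
    rw [mul_pow, e]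
    have : (2 : ℝ) ^ 90 ≤ (2 ^ 23) ^ 4 := by norm_num
    have := mul_le_mul_of_nonneg_right this h0
    linarith
  · have e2 : (b ^ 6 * a ^ 8 * l ^ 2 * Q) ^ (1 / 4 : ℝ) =
        b ^ (3 / 2 : ℝ) * a ^ 2 * l ^ (1 / 2 : ℝ) * Q ^ (1 / 4 : ℝ) := by
      rw [Real.mul_rpow (by positivity) hQ, Real.mul_rpow (by positivity) (by positivity),
        Real.mul_rpow (by positivity) (by positivity), key b hb, key a ha, key l hl,
        ← Real.rpow_natCast a 2]
      norm_num
    have e3 : l ^ (3 / 2 : ℝ) = l ^ (1 / 2 : ℝ) * l := by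
      conv_rhs => rw [← Real.rpow_one l, ← Real.rpow_mul hl.le, ← Real.rpow_add hl]
      norm_num
    rw [e2, e3]
    ring

lemma card_filter_sq_lt_le (S : Finset ℕ) (b : ℕ) :
    ((S.filter fun w => 1 ≤ w ∧ w ^ 2 < 2 * b).card : ℝ) ≤ 2 * √b := by
  have hsub : (S.filter fun w => 1 ≤ w ∧ w ^ 2 < 2 * b) ⊆ Finset.Icc 1 ⌊2 * √(b : ℝ)⌋₊ := by
    intro w hw
    obtain ⟨-, h1, h2⟩ := Finset.mem_filter.1 hw
    refine Finset.mem_Icc.2 ⟨h1, Nat.le_floor ?_⟩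
    refine le_of_pow_le_pow_left₀ (n := 2) (by norm_num) (by positivity) ?_
    rw [mul_pow, Real.sq_sqrt (Nat.cast_nonneg b)]
    have h3 : (w : ℝ) ^ 2 ≤ 2 * b := by exact_mod_cast h2.le
    have h4 : (0 : ℝ) ≤ b := Nat.cast_nonneg b
    linarith
  have := Finset.card_le_card hsub
  rw [Nat.card_Icc, Nat.add_sub_cancel] at this
  exact (Nat.cast_le.2 this).trans (Nat.floor_le (by positivity))

lemma sum_cube_mul_card_richLines_le {A B : Finset ℝ} (hA : 2 ≤ A.card) (hB : 1 ≤ B.card) :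
    ∑ w ∈ Finset.Icc 2 (min A.card B.card), (w : ℝ) ^ 3 * (richLines A B w).card ≤
      2 ^ 23 * (((addE ℝ A A : ℝ) * (addE ℝ B B : ℝ)) ^ (1 / 10 : ℝ) *
              (Ctuples ℝ 3 A B : ℝ) ^ (2 / 5 : ℝ) * (A.card : ℝ) ^ (8 / 5 : ℝ) *
              (B.card : ℝ) ^ (6 / 5 : ℝ) * Real.log A.card ^ (2 / 5 : ℝ)) +
      2 ^ 25 * (((mulEbar ℝ A : ℝ) * (mulEbar ℝ B : ℝ)) ^ (1 / 4 : ℝ) * (A.card : ℝ) ^ 2 *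
              (B.card : ℝ) ^ (3 / 2 : ℝ) * Real.log A.card ^ (3 / 2 : ℝ)) := by
  have ha : (1 : ℝ) ≤ A.card := by exact_mod_cast (by omega : 1 ≤ A.card)
  have hb : (1 : ℝ) ≤ B.card := by exact_mod_cast hB
  have hl := one_le_two_mul_log hA
  have hPA : (A.card : ℝ) ^ 2 ≤ addE ℝ A A := by exact_mod_cast card_sq_le_addE A
  have hPB : (B.card : ℝ) ^ 2 ≤ addE ℝ B B := by exact_mod_cast card_sq_le_addE B
  have hP : (A.card : ℝ) ^ 2 * (B.card : ℝ) ^ 2 ≤ (addE ℝ A A : ℝ) * addE ℝ B B :=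
    mul_le_mul hPA hPB (by positivity) (Nat.cast_nonneg _)
  have hC : (A.card : ℝ) * (B.card : ℝ) ^ 3 ≤ Ctuples ℝ 3 A B := by
    exact_mod_cast card_mul_pow_le_Ctuples A B 2
  have hQ : 0 ≤ (mulEbar ℝ A : ℝ) * mulEbar ℝ B :=
    mul_nonneg (Nat.cast_nonneg _) (Nat.cast_nonneg _)
  have hD : ∀ w : ℕ, (w : ℝ) ^ 3 * (richLines A B w).card ≤ 2 * Ctuples ℝ 3 A B := by
    intro w
    exact_mod_cast cube_mul_card_richLines_le A B w
  have hE : ∀ w : ℕ, 2 ≤ w → 2 * B.card ≤ w ^ 2 →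
      (w : ℝ) ^ 28 * ((richLines A B w).card : ℝ) ^ 6 ≤ 2 ^ 172 * (B.card : ℝ) ^ 12 *
        (A.card : ℝ) ^ 16 * Real.log A.card ^ 4 * (addE ℝ A A * addE ℝ B B) ∨
      (w : ℝ) ^ 16 * ((richLines A B w).card : ℝ) ^ 4 ≤ 2 ^ 90 * (B.card : ℝ) ^ 6 *
        (A.card : ℝ) ^ 8 * Real.log A.card ^ 2 * (mulEbar ℝ A * mulEbar ℝ B) := by
    intro w hw2 hwB
    refine card_rich_energy_bound hA (fun l hl => ?_) hw2 (fun l hl => ?_) hwB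
    · exact fst_ne_zero_of_mem_obliqueLines (Finset.mem_filter.1 hl).1
    · exact (Finset.mem_filter.1 hl).2
  have hG : ∀ w : ℕ, 2 ≤ w → w ≤ A.card → w ≤ B.card →
      (w : ℝ) ^ 3 * (richLines A B w).card ≤ 2 ^ 11 * (A.card : ℝ) ^ 2 * (B.card : ℝ) ^ 2 :=
    fun w => cube_mul_card_richLines_le_sq A B
  generalize (addE ℝ A A : ℝ) * addE ℝ B B = P at *
  generalize (mulEbar ℝ A : ℝ) * mulEbar ℝ B = Q at *
  generalize (Ctuples ℝ 3 A B : ℝ) = C at *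
  have hr0 : ∀ w : ℕ, (0 : ℝ) ≤ (richLines A B w).card := fun _ => Nat.cast_nonneg _
  obtain ⟨r, hr⟩ : ∃ r : ℕ → ℝ, ∀ w, r w = (richLines A B w).card := ⟨_, fun _ => rfl⟩
  simp only [← hr] at *
  have hl2 : 1 / 2 ≤ Real.log A.card := by linarith
  have hsmall := sq_mul_sq_mul_sqrt_le ha hb hP hC hl2
  obtain ⟨X, hX0, hX, hXR⟩ := exists_pow_six_eq (a := A.card) (b := B.card) (P := P) (C := C)
    (l := Real.log A.card) (by linarith) (by linarith) (lt_of_lt_of_le (by positivity) hP)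
    (lt_of_lt_of_le (by positivity) hC) (by linarith)
  obtain ⟨Y, hY0, hY, hYR⟩ := exists_pow_four_eq (a := A.card) (b := B.card) (Q := Q)
    (l := Real.log A.card) (by linarith) (by linarith) hQ (by linarith)
  have hC0 : 0 < C := lt_of_lt_of_le (by positivity) hC
  generalize P ^ (1 / 10 : ℝ) * C ^ (2 / 5 : ℝ) * (A.card : ℝ) ^ (8 / 5 : ℝ) *
              (B.card : ℝ) ^ (6 / 5 : ℝ) * Real.log A.card ^ (2 / 5 : ℝ) = R₁ at *
  generalize Q ^ (1 / 4 : ℝ) * (A.card : ℝ) ^ 2 *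
              (B.card : ℝ) ^ (3 / 2 : ℝ) * Real.log A.card ^ (3 / 2 : ℝ) = R₂ at *
  set S := Finset.Icc 2 (min A.card B.card) with hS
  have hmem : ∀ w ∈ S, 2 ≤ w ∧ w ≤ A.card ∧ w ≤ B.card := by
    intro w hw
    rw [hS, Finset.mem_Icc, le_min_iff] at hw
    exact hw
  have hT0 : ∀ w : ℕ, 0 ≤ (w : ℝ) ^ 3 * r w := fun w =>
    mul_nonneg (pow_nonneg (Nat.cast_nonneg _) _) (hr0 w)
  have hsum₁ : ∑ w ∈ S.filter (fun w => 1 ≤ w ∧ w ^ 2 < 2 * B.card), (w : ℝ) ^ 3 * r w ≤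
      2 ^ 13 * R₁ := by
    have h1 := Finset.sum_le_card_nsmul (S.filter fun w => 1 ≤ w ∧ w ^ 2 < 2 * B.card)
      (fun w : ℕ => (w : ℝ) ^ 3 * r w) (2 ^ 11 * (A.card : ℝ) ^ 2 * (B.card : ℝ) ^ 2)
      fun w hw => by
        obtain ⟨h2, h3, h4⟩ := hmem w (Finset.mem_filter.1 hw).1
        exact hG w h2 h3 h4
    rw [nsmul_eq_mul] at h1
    have h2 := mul_le_mul_of_nonneg_right (card_filter_sq_lt_le S B.card)
      (by positivity : 0 ≤ 2 ^ 11 * (A.card : ℝ) ^ 2 * (B.card : ℝ) ^ 2)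
    calc _ ≤ _ := h1
      _ ≤ _ := h2
      _ = 2 ^ 12 * ((A.card : ℝ) ^ 2 * (B.card : ℝ) ^ 2 * √(B.card : ℝ)) := by ring
      _ ≤ _ := by linarith
  set U := S.filter (fun w => ¬ (1 ≤ w ∧ w ^ 2 < 2 * B.card)) with hU
  have hUmem : ∀ w ∈ U, 2 ≤ w ∧ w ≤ A.card ∧ 2 * B.card ≤ w ^ 2 := by
    intro w hw
    rw [hU, Finset.mem_filter] at hw
    have := hmem w hw.1
    refine ⟨this.1, this.2.1, ?_⟩
    by_contra h
    exact hw.2 ⟨by omega, not_le.1 h⟩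
  have hsum₂ : ∑ w ∈ U.filter (fun w : ℕ => (w : ℝ) ^ 28 * r w ^ 6 ≤ X ^ 6),
      (w : ℝ) ^ 3 * r w ≤ 5 * (2 ^ 19 * R₁) := by
    refine (sum_le_of_pow_six_mul_pow_ten_le (by linarith : 0 < 2 * C) hX0
      (fun w _ => hT0 w) (fun w _ => hD w) (fun w hw => ?_) (fun w hw => ?_)).trans
      (mul_le_mul_of_nonneg_left hXR (by norm_num))
    · have := hUmem w (Finset.mem_filter.1 hw).1
      omega
    · calc _ = (w : ℝ) ^ 28 * r w ^ 6 := by ring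
        _ ≤ _ := (Finset.mem_filter.1 hw).2
  have hsum₃ : ∑ w ∈ U.filter (fun w : ℕ => ¬ (w : ℝ) ^ 28 * r w ^ 6 ≤ X ^ 6),
      (w : ℝ) ^ 3 * r w ≤ 3 * (2 ^ 23 * R₂) := by
    rw [← hYR]
    refine sum_le_of_pow_four_mul_pow_four_le hA hY0 (fun w hw => ?_) (fun w hw => ?_)
    · have := hUmem w (Finset.mem_filter.1 hw).1
      omega
    · obtain ⟨hwU, hw⟩ := Finset.mem_filter.1 hw
      obtain ⟨h2, -, h4⟩ := hUmem w hwU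
      have h5 := ((hE w h2 h4).resolve_left fun h => hw (h.trans hX)).trans hY
      calc _ = (w : ℝ) ^ 16 * r w ^ 4 := by ring
        _ ≤ _ := h5
  have hR₁ : 0 ≤ R₁ := by
    have : 0 ≤ (A.card : ℝ) ^ 2 * (B.card : ℝ) ^ 2 * √(B.card : ℝ) := by positivity
    linarith
  have hR₂ : 0 ≤ R₂ := by
    have : 0 ≤ Y * Real.log A.card := mul_nonneg hY0 (by linarith)
    linarith
  rw [← Finset.sum_filter_add_sum_filter_not S (fun w => 1 ≤ w ∧ w ^ 2 < 2 * B.card),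
    ← Finset.sum_filter_add_sum_filter_not U (fun w : ℕ => (w : ℝ) ^ 28 * r w ^ 6 ≤ X ^ 6)]
  linarith

theorem stmt0 :
    ∃ C : ℝ, 0 < C ∧ ∀ A B : Finset ℝ,
      (Ctuples ℝ 4 A B : ℝ) - B.card * (A.card : ℝ) ^ 4 - A.card * (B.card : ℝ) ^ 4 ≤
        C * ((B.card : ℝ) * (A.card : ℝ) ^ 3 + (A.card : ℝ) * (B.card : ℝ) ^ 3
          + ((addE ℝ A A : ℝ) * (addE ℝ B B : ℝ)) ^ (1 / 10 : ℝ) *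
              (Ctuples ℝ 3 A B : ℝ) ^ (2 / 5 : ℝ) * (A.card : ℝ) ^ (8 / 5 : ℝ) *
              (B.card : ℝ) ^ (6 / 5 : ℝ) * Real.log A.card ^ (2 / 5 : ℝ)
          + ((mulEbar ℝ A : ℝ) * (mulEbar ℝ B : ℝ)) ^ (1 / 4 : ℝ) * (A.card : ℝ) ^ 2 *
              (B.card : ℝ) ^ (3 / 2 : ℝ) * Real.log A.card ^ (3 / 2 : ℝ)) := by
  refine ⟨2 ^ 30, by norm_num, fun A B => ?_⟩
  have hmain : (Ctuples ℝ 4 A B : ℝ) ≤ A.card * (B.card : ℝ) ^ 4 + B.card * (A.card : ℝ) ^ 4 +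
      4 * ∑ w ∈ Finset.Icc 2 (min A.card B.card), (w : ℝ) ^ 3 * (richLines A B w).card := by
    have h1 := Ctuples_le A B 3
    have h2 := sum_fourth_le A B
    exact_mod_cast h1.trans (Nat.add_le_add_left h2 _)
  have hl : 0 ≤ Real.log (A.card : ℝ) := Real.log_natCast_nonneg _
  have h0 : 0 ≤ (B.card : ℝ) * (A.card : ℝ) ^ 3 + (A.card : ℝ) * (B.card : ℝ) ^ 3 := by
    positivity
  have h1 : 0 ≤ ((addE ℝ A A : ℝ) * (addE ℝ B B : ℝ)) ^ (1 / 10 : ℝ) *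
              (Ctuples ℝ 3 A B : ℝ) ^ (2 / 5 : ℝ) * (A.card : ℝ) ^ (8 / 5 : ℝ) *
              (B.card : ℝ) ^ (6 / 5 : ℝ) * Real.log A.card ^ (2 / 5 : ℝ) := by
    positivity
  have h2 : 0 ≤ ((mulEbar ℝ A : ℝ) * (mulEbar ℝ B : ℝ)) ^ (1 / 4 : ℝ) * (A.card : ℝ) ^ 2 *
              (B.card : ℝ) ^ (3 / 2 : ℝ) * Real.log A.card ^ (3 / 2 : ℝ) := by
    positivity
  rcases Nat.lt_or_ge (min A.card B.card) 2 with h | h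
  · rw [Finset.Icc_eq_empty (by omega), Finset.sum_empty] at hmain
    linarith
  · have hsum := sum_cube_mul_card_richLines_le (A := A) (B := B) (by omega) (by omega)
    linarith
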